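/- Let P = {τ₁,…,τₙ} be polygonal curves with vertices in general position, let k, ℓ ∈ ℕ, and let α > 0. Suppose there exists C* ⊆ Δ_ℓ with |C*| = k and cost_∞(P, C*) ≤ α. For each i let σ_i be an α-signature of τ_i, let V be the union of the vertex sets of the σ_i, and let U = ⋃_{w ∈ V} [w − 4α, w + 4α]. Then: (a) the Lebesgue measure of U is at most 24·α·k·ℓ, and (b) there exists a set Ĉ of k polygonal curves, each having at most ℓ vertices all of which lie in U, such that cost_∞(P, Ĉ) ≤ α. -/

import Mathlib

open Set

/-- A valid reparametrization of `[0,1]`: a continuous strictly increasing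
bijection of `[0,1]` onto itself fixing the endpoints. -/
def IsReparam (f : ℝ → ℝ) : Prop :=
  ContinuousOn f (Set.Icc 0 1) ∧ StrictMonoOn f (Set.Icc 0 1) ∧ f 0 = 0 ∧ f 1 = 1

/-- The Fréchet distance between two curves `τ, π : [0,1] → ℝ`:
`inf_f sup_{t ∈ [0,1]} |τ(f(t)) - π(t)|` over reparametrizations `f`. -/
noncomputable def frechetDist (τ π : ℝ → ℝ) : ℝ :=
  ⨅ f : {f : ℝ → ℝ // IsReparam f}, ⨆ t : Set.Icc (0:ℝ) 1, |τ (f.1 ↑t) - π ↑t|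

/-- `τ` is the polygonal curve on `[0,1]` with the `m` vertices `w 0, …, w (m-1)`
attained at parameters `t 0 = 0 < t 1 < … < t (m-1) = 1`, obtained by linear
interpolation. -/
def IsPolyOn (τ : ℝ → ℝ) (m : ℕ) (t w : ℕ → ℝ) : Prop :=
  2 ≤ m ∧ t 0 = 0 ∧ t (m - 1) = 1 ∧ (∀ i, i + 1 < m → t i < t (i + 1)) ∧
  (∀ i, i + 1 < m → ∀ u ∈ Set.Icc (t i) (t (i + 1)),
    τ u = w i + (u - t i) / (t (i + 1) - t i) * (w (i + 1) - w i))

/-- `τ` is a polygonal curve (with finitely many vertices). -/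
def IsPolyCurve (τ : ℝ → ℝ) : Prop := ∃ m t w, IsPolyOn τ m t w

/-- `c` is a polygonal curve with at most `ℓ` vertices, i.e. an element of `Δ_ℓ`. -/
def InDeltaL (ℓ : ℕ) (c : ℝ → ℝ) : Prop := ∃ m t w, m ≤ ℓ ∧ IsPolyOn c m t w

/-- General position of the vertex sequence `w 0, …, w (m-1)`: pairwise distinct
vertex values, pairwise distinct differences, and no vertex inside the closed
interval spanned by its two neighbours. -/
def GenPos (m : ℕ) (w : ℕ → ℝ) : Prop :=
  (∀ i j, i < m → j < m → i ≠ j → w i ≠ w j) ∧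
  (∀ i j p q, i < m → j < m → p < m → q < m → i ≠ j → p ≠ q →
      (i, j) ≠ (p, q) → w i - w j ≠ w p - w q) ∧
  (∀ i, i + 2 < m → w (i + 1) ∉ Set.uIcc (w i) (w (i + 2)))

/-- The parameters `s 0 = 0 < s 1 < … < s (ℓ-1) = 1` define a `δ`-signature of the
curve `τ` (Definition 3.3 of the paper, `0`-indexed): non-degeneracy,
direction-preservation, minimum edge length and range conditions. -/
def IsSignature (δ : ℝ) (τ : ℝ → ℝ) (ℓ : ℕ) (s : ℕ → ℝ) : Prop :=
  2 ≤ ℓ ∧ s 0 = 0 ∧ s (ℓ - 1) = 1 ∧ (∀ i, i + 1 < ℓ → s i < s (i + 1)) ∧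
  (∀ i, 1 ≤ i → i + 1 < ℓ → τ (s i) ∉ Set.uIcc (τ (s (i - 1))) (τ (s (i + 1)))) ∧
  (∀ i, i + 1 < ℓ → ∀ a b : ℝ, s i ≤ a → a < b → b ≤ s (i + 1) →
      (τ (s i) < τ (s (i + 1)) → τ a - τ b ≤ 2 * δ) ∧
      (τ (s (i + 1)) < τ (s i) → τ b - τ a ≤ 2 * δ)) ∧
  (∀ i, 1 ≤ i → i + 3 ≤ ℓ → 2 * δ < |τ (s (i + 1)) - τ (s i)|) ∧
  δ < |τ (s 1) - τ (s 0)| ∧ δ < |τ (s (ℓ - 1)) - τ (s (ℓ - 2))| ∧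
  (∀ i, 1 ≤ i → i + 3 ≤ ℓ → ∀ a ∈ Set.Icc (s i) (s (i + 1)),
      τ a ∈ Set.uIcc (τ (s i)) (τ (s (i + 1)))) ∧
  (2 < ℓ → ∀ a ∈ Set.Icc (s 0) (s 1),
      τ a ∈ Set.uIcc (τ (s 0)) (τ (s 1)) ∪ Set.Icc (τ (s 0) - δ) (τ (s 0) + δ)) ∧
  (2 < ℓ → ∀ a ∈ Set.Icc (s (ℓ - 2)) (s (ℓ - 1)),
      τ a ∈ Set.uIcc (τ (s (ℓ - 2))) (τ (s (ℓ - 1))) ∪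
        Set.Icc (τ (s (ℓ - 1)) - δ) (τ (s (ℓ - 1)) + δ)) ∧
  (ℓ = 2 → ∀ a ∈ Set.Icc (s 0) (s 1),
      τ a ∈ Set.uIcc (τ (s 0)) (τ (s 1)) ∪ Set.Icc (τ (s 0) - δ) (τ (s 0) + δ) ∪
        Set.Icc (τ (s 1) - δ) (τ (s 1) + δ))

/-- `k`-center cost: `max_i min_j d_F(τ i, C j)`. -/
noncomputable def costC (n k : ℕ) (τ C : ℕ → ℝ → ℝ) : ℝ :=
  ⨆ i : Fin n, ⨅ j : Fin k, frechetDist (τ i) (C j)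

/-- A monotone step in the free space of `τ` and `π`: the whole box spanned by `p` and `q`
consists of pairs of parameters at which the two curves are within `ε` of each other. -/
def FreeStep (τ π : ℝ → ℝ) (ε : ℝ) (p q : ℝ × ℝ) : Prop :=
  p.1 ≤ q.1 ∧ p.2 ≤ q.2 ∧ ∀ y ∈ Icc p.1 q.1, ∀ x ∈ Icc p.2 q.2, |τ y - π x| ≤ ε

/-- Reachability in the free space by finitely many monotone boxes. -/
def FreeReach (τ π : ℝ → ℝ) (ε : ℝ) : ℝ × ℝ → ℝ × ℝ → Prop :=
  Relation.ReflTransGen (FreeStep τ π ε)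

lemma FreeReach.of_box {τ π : ℝ → ℝ} {ε y y' x x' : ℝ} (hy : y ≤ y') (hx : x ≤ x')
    (h : ∀ a ∈ Icc y y', ∀ b ∈ Icc x x', |τ a - π b| ≤ ε) :
    FreeReach τ π ε (y, x) (y', x') :=
  Relation.ReflTransGen.single ⟨hy, hx, h⟩

lemma FreeReach.trans {τ π : ℝ → ℝ} {ε : ℝ} {p q r : ℝ × ℝ} (h₁ : FreeReach τ π ε p q)
    (h₂ : FreeReach τ π ε q r) : FreeReach τ π ε p r :=
  Relation.ReflTransGen.trans h₁ h₂

lemma FreeReach.neg {τ π : ℝ → ℝ} {ε : ℝ} {p q : ℝ × ℝ} (h : FreeReach τ π ε p q) :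
    FreeReach (fun y => -τ y) (fun x => -π x) ε p q := by
  refine Relation.ReflTransGen.mono ?_ _ _ h
  rintro a b ⟨h1, h2, h3⟩
  refine ⟨h1, h2, fun y hy x hx => ?_⟩
  have := h3 y hy x hx
  rwa [← neg_sub', abs_neg]

lemma FreeReach.reverse {τ π : ℝ → ℝ} {ε : ℝ} {p q : ℝ × ℝ} (h : FreeReach τ π ε p q) :
    FreeReach (fun y => τ (1 - y)) (fun x => π (1 - x)) ε (1 - q.1, 1 - q.2)
      (1 - p.1, 1 - p.2) := by
  induction h with
  | refl => exact Relation.ReflTransGen.refl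
  | tail _ hs ih =>
    obtain ⟨h1, h2, h3⟩ := hs
    refine FreeReach.trans (FreeReach.of_box (by linarith) (by linarith) ?_) ih
    intro a ha b hb
    exact h3 _ ⟨by linarith [ha.2], by linarith [ha.1]⟩ _ ⟨by linarith [hb.2], by linarith [hb.1]⟩

/-- Reachability is preserved when the second curve is precomposed with a monotone change of
parameter. -/
lemma FreeReach.of_comp {τ κ π φ : ℝ → ℝ} {ε a b : ℝ} (hφc : ContinuousOn φ (Icc a b))
    (hφm : MonotoneOn φ (Icc a b)) (hκ : ∀ x ∈ Icc a b, κ x = π (φ x)) {p q : ℝ × ℝ}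
    (h : FreeReach τ κ ε p q) (hp : a ≤ p.2) (hq : q.2 ≤ b) :
    FreeReach τ π ε (p.1, φ p.2) (q.1, φ q.2) ∧ p.2 ≤ q.2 := by
  induction h with
  | refl => exact ⟨Relation.ReflTransGen.refl, le_rfl⟩
  | @tail r s _ hs ih =>
    obtain ⟨h1, h2, h3⟩ := hs
    obtain ⟨ih1, ih2⟩ := ih (h2.trans hq)
    have hr : r.2 ∈ Icc a b := ⟨hp.trans ih2, h2.trans hq⟩
    have hs' : s.2 ∈ Icc a b := ⟨hr.1.trans h2, hq⟩
    refine ⟨ih1.trans (FreeReach.of_box h1 (hφm hr hs' h2) ?_), ih2.trans h2⟩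
    intro y hy x hx
    obtain ⟨ξ, hξ, rfl⟩ := intermediate_value_Icc h2
      (hφc.mono (Icc_subset_Icc hr.1 hs'.2)) hx
    rw [← hκ ξ ⟨hr.1.trans hξ.1, hξ.2.trans hs'.2⟩]
    exact h3 y hy ξ hξ

/-- A matching along a monotone reparametrization yields reachability, at an arbitrarily small
loss. -/
lemma FreeReach.of_matching {τ π f : ℝ → ℝ} {δ η x x' : ℝ} (hη : 0 < η) (hx : x ≤ x')
    (hf : ContinuousOn f (Icc x x')) (hfm : MonotoneOn f (Icc x x'))
    (hπ : ContinuousOn π (Icc x x')) (hm : ∀ ξ ∈ Icc x x', |τ (f ξ) - π ξ| ≤ δ) :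
    FreeReach τ π (δ + η) (f x, x) (f x', x') := by
  have huc := isCompact_Icc.uniformContinuousOn_of_continuous hπ
  obtain ⟨d, hd, hdd⟩ := Metric.uniformContinuousOn_iff.1 huc η hη
  obtain ⟨N, hN⟩ := exists_nat_gt ((x' - x) / d)
  have key : ∀ r : ℕ, FreeReach τ π (δ + η) (f x, x)
      (f (min x' (x + r * (d / 2))), min x' (x + r * (d / 2))) := by
    intro r
    induction r with
    | zero => simp [hx]; exact Relation.ReflTransGen.refl
    | succ r ih =>
      refine ih.trans ?_
      set u := min x' (x + r * (d / 2)) with hu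
      set v := min x' (x + ((r + 1 : ℕ) : ℝ) * (d / 2)) with hv
      have hr : (0 : ℝ) ≤ r * (d / 2) := by positivity
      have hu1 : u ∈ Icc x x' := ⟨le_min hx (by linarith), min_le_left _ _⟩
      have hv1 : v ∈ Icc x x' := ⟨le_min hx (by push_cast; nlinarith), min_le_left _ _⟩
      have huv : u ≤ v := min_le_min le_rfl (by push_cast; nlinarith)
      have hvu : v ≤ u + d / 2 := by
        rw [hu, hv, ← min_add_add_right]
        refine min_le_min (by linarith) (by push_cast; linarith)
      refine FreeReach.of_box (hfm hu1 hv1 huv) huv ?_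
      intro y hy ξ hξ
      obtain ⟨ζ, hζ, rfl⟩ := intermediate_value_Icc huv
        (hf.mono (Icc_subset_Icc hu1.1 hv1.2)) hy
      have hζ' : ζ ∈ Icc x x' := ⟨hu1.1.trans hζ.1, hζ.2.trans hv1.2⟩
      have hξ' : ξ ∈ Icc x x' := ⟨hu1.1.trans hξ.1, hξ.2.trans hv1.2⟩
      have h1 := hm ζ hζ'
      have h2 := hdd ζ hζ' ξ hξ' (by
        rw [Real.dist_eq, abs_lt]; constructor <;> linarith [hζ.1, hζ.2, hξ.1, hξ.2])
      rw [Real.dist_eq] at h2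
      calc |τ (f ζ) - π ξ| = |(τ (f ζ) - π ζ) + (π ζ - π ξ)| := by ring_nf
        _ ≤ _ := (abs_add_le _ _).trans (by linarith)
  have hfin : min x' (x + (2 * N : ℕ) * (d / 2)) = x' := by
    apply min_eq_left
    rw [div_lt_iff₀ hd] at hN
    push_cast
    linarith
  have := key (2 * N)
  rwa [hfin] at this

/-- A chain of boxes is traversed by a pair of continuous monotone functions. -/
lemma FreeReach.exists_path {τ π : ℝ → ℝ} {ε : ℝ} {p q : ℝ × ℝ} (h : FreeReach τ π ε p q)
    (hpq : |τ p.1 - π p.2| ≤ ε) :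
    ∃ (N : ℕ) (Y X : ℝ → ℝ), Continuous Y ∧ Continuous X ∧ Monotone Y ∧ Monotone X ∧
      Y 0 = p.1 ∧ X 0 = p.2 ∧ Y N = q.1 ∧ X N = q.2 ∧
      ∀ s ∈ Icc (0 : ℝ) N, |τ (Y s) - π (X s)| ≤ ε := by
  induction h with
  | refl =>
    refine ⟨0, fun _ => p.1, fun _ => p.2, continuous_const, continuous_const,
      monotone_const, monotone_const, rfl, rfl, rfl, rfl, fun _ _ => hpq⟩
  | @tail r q _ hs ih =>
    obtain ⟨N, Y, X, hYc, hXc, hYm, hXm, hY0, hX0, hYN, hXN, hb⟩ := ih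
    obtain ⟨h1, h2, h3⟩ := hs
    have hN : (0 : ℝ) ≤ N := Nat.cast_nonneg N
    have hmono : ∀ (Z : ℝ → ℝ) (d : ℝ), Monotone Z → 0 ≤ d →
        Monotone fun s => Z (min s N) + d * max 0 (min 1 (s - N)) := by
      intro Z d hZ hd a b hab
      refine add_le_add (hZ (min_le_min hab le_rfl)) (mul_le_mul_of_nonneg_left ?_ hd)
      exact max_le_max le_rfl (min_le_min le_rfl (by linarith))
    refine ⟨N + 1, fun s => Y (min s N) + (q.1 - r.1) * max 0 (min 1 (s - N)),
      fun s => X (min s N) + (q.2 - r.2) * max 0 (min 1 (s - N)), by fun_prop, by fun_prop,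
      hmono _ _ hYm (by linarith), hmono _ _ hXm (by linarith), ?_, ?_, ?_, ?_, ?_⟩
    · have : min 1 (0 - (N : ℝ)) ≤ 0 := (min_le_right _ _).trans (by linarith)
      simp only [max_eq_left this, min_eq_left hN, mul_zero, add_zero, hY0]
    · have : min 1 (0 - (N : ℝ)) ≤ 0 := (min_le_right _ _).trans (by linarith)
      simp only [max_eq_left this, min_eq_left hN, mul_zero, add_zero, hX0]
    · simp [hYN]
    · simp [hXN]
    · intro s hs
      rcases le_total s N with hsN | hsN
      · have : min 1 (s - (N : ℝ)) ≤ 0 := (min_le_right _ _).trans (by linarith)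
        simp only [max_eq_left this, min_eq_left hsN, mul_zero, add_zero]
        exact hb s ⟨hs.1, hsN⟩
      · have hs2 : s - N ≤ 1 := by have := hs.2; push_cast at this; linarith
        have h0 : 0 ≤ s - N := by linarith
        simp only [min_eq_right hsN, min_eq_right hs2, max_eq_right h0, hYN, hXN]
        apply h3 <;> constructor <;> nlinarith

lemma frechetDist_le_of_freeReach {τ π : ℝ → ℝ} {α : ℝ} (hτ : ContinuousOn τ (Icc 0 1))
    (hπ : ContinuousOn π (Icc 0 1)) (h0 : |τ 0 - π 0| ≤ α)
    (h : ∀ ε > 0, FreeReach τ π (α + ε) (0, 0) (1, 1)) : frechetDist τ π ≤ α := by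
  refine le_of_forall_pos_le_add fun ε hε => ?_
  obtain ⟨N, Y, X, hYc, hXc, hYm, hXm, hY0, hX0, hYN, hXN, hb⟩ :=
    (h (ε / 3) (by positivity)).exists_path (by simpa using h0.trans (by linarith))
  simp only at hY0 hX0 hYN hXN
  have hN : (0 : ℝ) < N := by
    rcases Nat.eq_zero_or_pos N with h | h
    · subst h; norm_num [hY0] at hYN
    · exact_mod_cast h
  obtain ⟨d₁, hd₁, hτu⟩ := Metric.uniformContinuousOn_iff.1
    (isCompact_Icc.uniformContinuousOn_of_continuous hτ) (ε / 3) (by positivity)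
  obtain ⟨d₂, hd₂, hπu⟩ := Metric.uniformContinuousOn_iff.1
    (isCompact_Icc.uniformContinuousOn_of_continuous hπ) (ε / 3) (by positivity)
  obtain ⟨κ, hκ0, hκ⟩ : ∃ κ : ℝ, 0 < κ ∧ κ < min (min d₁ d₂) 1 :=
    exists_between (by positivity)
  have hκ1 : κ < 1 := hκ.trans_le (min_le_right _ _)
  have hκd₁ : κ < d₁ := hκ.trans_le ((min_le_left _ _).trans (min_le_left _ _))
  have hκd₂ : κ < d₂ := hκ.trans_le ((min_le_left _ _).trans (min_le_right _ _))
  have hsm : ∀ Z : ℝ → ℝ, Monotone Z → StrictMono fun s => (1 - κ) * Z s + κ * (s / N) := by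
    intro Z hZ a b hab
    refine add_lt_add_of_le_of_lt (mul_le_mul_of_nonneg_left (hZ hab.le) (by linarith)) ?_
    exact mul_lt_mul_of_pos_left (div_lt_div_of_pos_right hab hN) hκ0
  have hcl : ∀ Z : ℝ → ℝ, Monotone Z → Z 0 = 0 → Z N = 1 → ∀ s ∈ Icc (0 : ℝ) N,
      Z s ∈ Icc (0 : ℝ) 1 ∧ (1 - κ) * Z s + κ * (s / N) ∈ Icc (0 : ℝ) 1 ∧
        |(1 - κ) * Z s + κ * (s / N) - Z s| ≤ κ := by
    intro Z hZ h0 h1 s hs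
    have a1 : 0 ≤ Z s := h0 ▸ hZ hs.1
    have a2 : Z s ≤ 1 := h1 ▸ hZ hs.2
    have a3 : 0 ≤ s / N := div_nonneg hs.1 hN.le
    have a4 : s / N ≤ 1 := (div_le_one hN).2 hs.2
    refine ⟨⟨a1, a2⟩, ⟨by nlinarith, by nlinarith⟩, ?_⟩
    rw [show (1 - κ) * Z s + κ * (s / N) - Z s = κ * (s / N - Z s) by ring, abs_le]
    constructor <;> nlinarith
  set X' : ℝ → ℝ := fun s => (1 - κ) * X s + κ * (s / N) with hX'
  set Y' : ℝ → ℝ := fun s => (1 - κ) * Y s + κ * (s / N) with hY'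
  have hX'c : Continuous X' := by fun_prop
  have hY'c : Continuous Y' := by fun_prop
  have hsurj : Function.Surjective X' := by
    have hlin : Filter.Tendsto (fun s : ℝ => κ * (s / N)) Filter.atTop Filter.atTop :=
      (Filter.tendsto_id.atTop_div_const hN).const_mul_atTop hκ0
    have hlin' : Filter.Tendsto (fun s : ℝ => κ * (s / N)) Filter.atBot Filter.atBot :=
      (Filter.tendsto_id.atBot_div_const hN).const_mul_atBot hκ0
    refine hX'c.surjective (Filter.tendsto_atTop_mono' _ ?_ hlin)
      (Filter.tendsto_atBot_mono' _ ?_ hlin')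
    · filter_upwards [Filter.eventually_ge_atTop 0] with s hs
      have : 0 ≤ X s := hX0 ▸ hXm hs
      have : 0 ≤ (1 - κ) * X s := mul_nonneg (by linarith) this
      simp only [hX']; linarith
    · filter_upwards [Filter.eventually_le_atBot 0] with s hs
      have : X s ≤ 0 := hX0 ▸ hXm hs
      have : (1 - κ) * X s ≤ 0 := mul_nonpos_of_nonneg_of_nonpos (by linarith) this
      simp only [hX']; linarith
  let e := (hsm X hXm).orderIsoOfSurjective X' hsurj
  have he : ∀ s, e s = X' s := fun s => rfl
  have e0 : e.symm 0 = 0 := by rw [e.symm_apply_eq, he]; simp [hX', hX0]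
  have e1 : e.symm 1 = N := by
    rw [e.symm_apply_eq, he]; simp [hX', hXN, div_self hN.ne']
  have hf : IsReparam (Y' ∘ e.symm) := by
    refine ⟨(hY'c.comp e.symm.continuous).continuousOn,
      ((hsm Y hYm).comp e.symm.strictMono).strictMonoOn _, ?_, ?_⟩
    · simp [e0, hY', hY0]
    · simp [e1, hY', hYN, div_self hN.ne']
  refine ciInf_le_of_le ⟨0, ?_⟩ ⟨_, hf⟩ ?_
  · rintro _ ⟨f, rfl⟩
    exact Real.iSup_nonneg fun _ => abs_nonneg _
  · have : Nonempty (Icc (0 : ℝ) 1) := ⟨⟨0, by simp⟩⟩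
    refine ciSup_le fun ⟨x, hx⟩ => ?_
    have hs : e.symm x ∈ Icc (0 : ℝ) N :=
      ⟨e0 ▸ e.symm.monotone hx.1, e1 ▸ e.symm.monotone hx.2⟩
    have hxs : x = X' (e.symm x) := by rw [← he, e.apply_symm_apply]
    obtain ⟨b1, b2, b3⟩ := hcl X hXm hX0 hXN _ hs
    obtain ⟨c1, c2, c3⟩ := hcl Y hYm hY0 hYN _ hs
    have k1 := hb _ hs
    have k2 := hτu _ c2 _ c1 (by rw [Real.dist_eq]; exact c3.trans_lt hκd₁)
    have k3 := hπu _ b2 _ b1 (by rw [Real.dist_eq]; exact b3.trans_lt hκd₂)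
    rw [Real.dist_eq, abs_lt] at k2 k3
    rw [abs_le] at k1 ⊢
    change -(α + ε) ≤ τ (Y' (e.symm x)) - π x ∧ τ (Y' (e.symm x)) - π x ≤ α + ε
    rw [congrArg π hxs]
    constructor <;> simp only [hX', hY'] <;> linarith [k1.1, k1.2, k2.1, k2.2, k3.1, k3.2]

lemma exists_isReparam_of_frechetDist_le {τ π : ℝ → ℝ} {α ε : ℝ}
    (hτ : ContinuousOn τ (Icc 0 1)) (hπ : ContinuousOn π (Icc 0 1))
    (h : frechetDist τ π ≤ α) (hε : 0 < ε) :
    ∃ f, IsReparam f ∧ ∀ x ∈ Icc (0 : ℝ) 1, |τ (f x) - π x| ≤ α + ε := by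
  have : Nonempty {f : ℝ → ℝ // IsReparam f} :=
    ⟨⟨id, continuousOn_id, strictMono_id.strictMonoOn _, rfl, rfl⟩⟩
  obtain ⟨⟨f, hf⟩, hlt⟩ := exists_lt_of_ciInf_lt (h.trans_lt (lt_add_of_pos_right α hε))
  refine ⟨f, hf, fun x hx => ?_⟩
  refine le_trans ?_ hlt.le
  have hmaps : MapsTo f (Icc 0 1) (Icc 0 1) := by
    intro z hz
    obtain ⟨_, hm, h0, h1⟩ := hf
    exact ⟨h0 ▸ hm.monotoneOn (by simp) hz hz.1, h1 ▸ hm.monotoneOn hz (by simp) hz.2⟩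
  have hc : ContinuousOn (fun x => |τ (f x) - π x|) (Icc 0 1) :=
    ((hτ.comp hf.1 hmaps).sub hπ).abs
  have hb := isCompact_Icc.bddAbove_image hc
  refine le_ciSup (f := fun t : Icc (0 : ℝ) 1 => |τ (f t) - π t|) ?_ ⟨x, hx⟩
  refine hb.mono ?_
  rintro _ ⟨t, rfl⟩
  exact ⟨t, t.2, rfl⟩

lemma exists_first_hit_up {g : ℝ → ℝ} {a b v : ℝ} (hab : a ≤ b) (hg : ContinuousOn g (Icc a b))
    (ha : g a ≤ v) (hb : v ≤ g b) : ∃ c ∈ Icc a b, g c = v ∧ ∀ x ∈ Icc a c, g x ≤ v := by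
  have hc : IsCompact (Icc a b ∩ g ⁻¹' Ici v) :=
    isCompact_Icc.of_isClosed_subset (hg.preimage_isClosed_of_isClosed isClosed_Icc isClosed_Ici)
      inter_subset_left
  obtain ⟨c, ⟨hcm, hcv⟩, hleast⟩ := hc.exists_isLeast ⟨b, ⟨hab, le_rfl⟩, hb⟩
  obtain ⟨x, hx, hxv⟩ := intermediate_value_Icc hcm.1 (hg.mono (Icc_subset_Icc_right hcm.2))
    ⟨ha, hcv⟩
  have hcx : c ≤ x := hleast ⟨⟨hx.1, hx.2.trans hcm.2⟩, hxv.ge⟩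
  have hxc : x = c := le_antisymm hx.2 hcx
  refine ⟨c, hcm, hxc ▸ hxv, fun y hy => ?_⟩
  by_contra! hlt
  have : c = y := le_antisymm (hleast ⟨⟨hy.1, hy.2.trans hcm.2⟩, hlt.le⟩) hy.2
  rw [← this, ← hxc, hxv] at hlt
  exact lt_irrefl _ hlt

lemma exists_last_hit_down {g : ℝ → ℝ} {a b v : ℝ} (hab : a ≤ b) (hg : ContinuousOn g (Icc a b))
    (ha : v ≤ g a) (hb : g b ≤ v) : ∃ c ∈ Icc a b, g c = v ∧ ∀ x ∈ Icc c b, g x ≤ v := by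
  have hmaps : MapsTo (fun x : ℝ => -x) (Icc (-b) (-a)) (Icc a b) :=
    fun x hx => ⟨by linarith [hx.2], by linarith [hx.1]⟩
  obtain ⟨c, hc, hcv, hcl⟩ := exists_first_hit_up (g := fun x => g (-x)) (v := v)
    (neg_le_neg hab) (hg.comp continuous_neg.continuousOn hmaps) (by simpa using hb)
    (by simpa using ha)
  refine ⟨-c, hmaps hc, hcv, fun x hx => ?_⟩
  simpa using hcl (-x) ⟨by linarith [hx.2], by linarith [hx.1]⟩

lemma exists_first_hit_down {g : ℝ → ℝ} {a b v : ℝ} (hab : a ≤ b)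
    (hg : ContinuousOn g (Icc a b)) (ha : v ≤ g a) (hb : g b ≤ v) :
    ∃ c ∈ Icc a b, g c = v ∧ ∀ x ∈ Icc a c, v ≤ g x := by
  obtain ⟨c, hc, hcv, hcl⟩ := exists_first_hit_up hab hg.neg (neg_le_neg ha) (neg_le_neg hb)
  exact ⟨c, hc, neg_injective hcv, fun x hx => neg_le_neg_iff.1 (hcl x hx)⟩

lemma exists_last_hit_up {g : ℝ → ℝ} {a b v : ℝ} (hab : a ≤ b) (hg : ContinuousOn g (Icc a b))
    (ha : g a ≤ v) (hb : v ≤ g b) : ∃ c ∈ Icc a b, g c = v ∧ ∀ x ∈ Icc c b, v ≤ g x := by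
  obtain ⟨c, hc, hcv, hcl⟩ := exists_last_hit_down hab hg.neg (neg_le_neg ha) (neg_le_neg hb)
  exact ⟨c, hc, neg_injective hcv, fun x hx => neg_le_neg_iff.1 (hcl x hx)⟩

/-- The maximal final stretch of `[a, b]` on which `g` stays in `[μ, p]`. -/
lemma exists_last_stay {g : ℝ → ℝ} {a b μ p : ℝ} (hab : a ≤ b) (hg : ContinuousOn g (Icc a b))
    (hb : g b ∈ Icc μ p) :
    ∃ c ∈ Icc a b, (∀ x ∈ Icc c b, g x ∈ Icc μ p) ∧ (c = a ∨ g c = μ ∨ g c = p) := by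
  obtain ⟨c, hc, hcl, hcc⟩ : ∃ c ∈ Icc a b, (∀ x ∈ Icc c b, μ ≤ g x) ∧ (c = a ∨ g c = μ) := by
    by_cases h : ∀ x ∈ Icc a b, μ ≤ g x
    · exact ⟨a, ⟨le_rfl, hab⟩, h, Or.inl rfl⟩
    · push Not at h
      obtain ⟨x, hx, hxμ⟩ := h
      obtain ⟨c, hc, hcv, hcl⟩ := exists_last_hit_up hx.2
        (hg.mono (Icc_subset_Icc_left hx.1)) hxμ.le hb.1
      exact ⟨c, ⟨hx.1.trans hc.1, hc.2⟩, hcl, Or.inr hcv⟩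
  by_cases h : ∀ x ∈ Icc c b, g x ≤ p
  · exact ⟨c, hc, fun x hx => ⟨hcl x hx, h x hx⟩, hcc.imp_right Or.inl⟩
  · push Not at h
    obtain ⟨x, hx, hxp⟩ := h
    obtain ⟨d, hd, hdv, hdl⟩ := exists_last_hit_down hx.2
      (hg.mono (Icc_subset_Icc_left (hc.1.trans hx.1))) hxp.le hb.2
    have hcd : c ≤ d := hx.1.trans hd.1
    exact ⟨d, ⟨hc.1.trans hcd, hd.2⟩,
      fun z hz => ⟨hcl z ⟨hcd.trans hz.1, hz.2⟩, hdl z hz⟩, Or.inr (Or.inr hdv)⟩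

/-- Two curves without large backward movement can be swept simultaneously. -/
lemma FreeReach.of_sweep {τ π : ℝ → ℝ} {δ η μ p y₀ θ y₁ x₀ x₁ ξ : ℝ} (hη : 0 < η)
    (hτ : ContinuousOn τ (Icc y₀ y₁)) (hπ : ContinuousOn π (Icc x₀ x₁))
    (hθ : θ ∈ Icc y₀ y₁) (hξ : ξ ∈ Icc x₀ x₁) (hτθ : τ θ = p + δ) (hπξ : π ξ = μ)
    (hπ₁ : π x₁ = p) (hπr : ∀ x ∈ Icc x₀ x₁, π x ∈ Icc μ p)
    (hτr : ∀ y ∈ Icc y₀ y₁, τ y ∈ Icc (μ - δ) (p + δ))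
    (hback : ∀ a b, y₀ ≤ a → a ≤ b → b ≤ y₁ → τ a - τ b ≤ 2 * δ)
    (hV : τ y₀ ∈ Icc (p - δ) (μ + δ)) :
    FreeReach τ π (δ + η) (y₀, x₀) (y₁, x₁) := by
  have hμp : μ ≤ p := (hπr ξ hξ).1.trans (hπr ξ hξ).2
  obtain ⟨N, hN⟩ := exists_nat_gt ((p - μ) / η)
  have hN0 : (0 : ℝ) < N := lt_of_le_of_lt (div_nonneg (by linarith) hη.le) hN
  set d := (p - μ) / N with hd
  have hd0 : 0 ≤ d := div_nonneg (by linarith) hN0.le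
  have hdη : d ≤ η := by
    rw [hd, div_le_iff₀ hN0]
    rw [div_lt_iff₀ hη] at hN
    linarith
  have hNd : N * d = p - μ := mul_div_cancel₀ _ hN0.ne'
  have key : ∀ r : ℕ, r ≤ N → ∃ a ∈ Icc y₀ θ, ∃ b ∈ Icc x₀ x₁,
      FreeReach τ π (δ + η) (y₀, x₀) (a, b) ∧ τ a = μ + r * d + δ ∧ π b = μ + r * d ∧
      ∀ x ∈ Icc b x₁, μ + r * d ≤ π x := by
    intro r
    induction r with
    | zero =>
      intro _
      obtain ⟨a, ha, hav, hal⟩ := exists_first_hit_up (v := μ + δ) hθ.1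
        (hτ.mono (Icc_subset_Icc_right hθ.2)) hV.2 (by linarith)
      refine ⟨a, ha, ξ, hξ, FreeReach.trans (r := (a, ξ)) (q := (y₀, ξ)) ?_ ?_, by simp [hav],
        by simp [hπξ], fun x hx => by simpa using (hπr x ⟨hξ.1.trans hx.1, hx.2⟩).1⟩
      · refine FreeReach.of_box le_rfl hξ.1 fun y hy x hx => ?_
        have hy' : y = y₀ := le_antisymm hy.2 hy.1
        have := hπr x ⟨hx.1, hx.2.trans hξ.2⟩
        rw [hy', abs_le]
        constructor <;> linarith [hV.1, hV.2, this.1, this.2]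
      · refine FreeReach.of_box ha.1 le_rfl fun y hy x hx => ?_
        have hx' : x = ξ := le_antisymm hx.2 hx.1
        have h1 := hτr y ⟨hy.1, hy.2.trans (ha.2.trans hθ.2)⟩
        have h2 := hal y hy
        rw [hx', hπξ, abs_le]
        constructor <;> linarith [h1.1]
    | succ r ih =>
      intro hr
      obtain ⟨a, ha, b, hb, hreach, hav, hbv, hbl⟩ := ih (by omega)
      have hrd : ((r + 1 : ℕ) : ℝ) * d ≤ p - μ := by
        rw [← hNd]; exact mul_le_mul_of_nonneg_right (by exact_mod_cast hr) hd0
      have hrd0 : 0 ≤ (r : ℝ) * d := by positivity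
      have hexp : ((r + 1 : ℕ) : ℝ) * d = r * d + d := by push_cast; ring
      rw [hexp] at hrd ⊢
      obtain ⟨a', ha', hav', hal'⟩ := exists_first_hit_up (v := μ + (r * d + d) + δ) ha.2
        (hτ.mono (Icc_subset_Icc ha.1 hθ.2)) (by linarith) (by linarith)
      obtain ⟨b', hb', hbv', hbl'⟩ := exists_last_hit_up (v := μ + (r * d + d)) hb.2
        (hπ.mono (Icc_subset_Icc_left hb.1)) (by linarith) (by linarith)
      refine ⟨a', ⟨ha.1.trans ha'.1, ha'.2⟩, b', ⟨hb.1.trans hb'.1, hb'.2⟩,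
        hreach.trans (FreeReach.trans (q := (a', b)) ?_ ?_), hav', hbv', hbl'⟩
      · refine FreeReach.of_box ha'.1 le_rfl fun y hy x hx => ?_
        have hx' : x = b := le_antisymm hx.2 hx.1
        have h1 := hback a y ha.1 hy.1 (hy.2.trans (ha'.2.trans hθ.2))
        have h2 := hal' y hy
        rw [hx', hbv, abs_le]
        constructor <;> linarith
      · refine FreeReach.of_box le_rfl hb'.1 fun y hy x hx => ?_
        have hy' : y = a' := le_antisymm hy.2 hy.1
        have h1 := hbl x ⟨hx.1, hx.2.trans hb'.2⟩
        have h2 := hπr x ⟨hb.1.trans hx.1, hx.2.trans hb'.2⟩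
        rw [hy', hav', abs_le]
        constructor <;> linarith [h2.2, hV.1, hV.2]
  obtain ⟨a, ha, b, hb, hreach, hav, hbv, hbl⟩ := key N le_rfl
  rw [hNd] at hav hbv hbl
  have hay : a ≤ y₁ := ha.2.trans hθ.2
  refine hreach.trans (FreeReach.of_box hay hb.2 fun y hy x hx => ?_)
  have h1 := hback a y ha.1 hy.1 hy.2
  have h2 := hτr y ⟨ha.1.trans hy.1, hy.2⟩
  have h3 := hbl x hx
  have h4 := hπr x ⟨hb.1.trans hx.1, hx.2⟩
  rw [abs_le]
  constructor <;> linarith [h2.2, h4.2]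

/-- Around the parameter `y`, the curve `τ` rises from far below `u` to far above `u` with
backward movement at most `2 * δ`, and the rise is guarded at both ends. -/
def UpAt (δ : ℝ) (τ : ℝ → ℝ) (u y : ℝ) : Prop :=
  ∃ ys ye, 0 ≤ ys ∧ ys ≤ y ∧ y ≤ ye ∧ ye ≤ 1 ∧
    (∀ a b, ys ≤ a → a ≤ b → b ≤ ye → τ a - τ b ≤ 2 * δ) ∧
    τ ys + 3 * δ < u ∧ u + 3 * δ < τ ye ∧
    (ys = 0 ∨ τ ys + 5 * δ < u ∨
      ∃ z, 0 ≤ z ∧ z ≤ ys ∧ (∀ a ∈ Icc z ye, τ ys ≤ τ a) ∧ τ ys + 2 * δ < τ z) ∧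
    (ye = 1 ∨ u + 5 * δ < τ ye ∨
      ∃ z, ye ≤ z ∧ z ≤ 1 ∧ (∀ a ∈ Icc ys z, τ a ≤ τ ye) ∧ τ z + 2 * δ < τ ye)

/-- Cutting a bump of the second curve off at the level `h` preserves the matching, provided that
the first curve is rising around the peak of the bump. -/
lemma FreeReach.of_cut {τ π f κ : ℝ → ℝ} {δ η h x z₁ z₂ : ℝ} (hδ : 0 < δ) (hη : 0 < η)
    (hτ : ContinuousOn τ (Icc 0 1)) (hπ : ContinuousOn π (Icc 0 1))
    (hf : ContinuousOn f (Icc 0 1)) (hfm : MonotoneOn f (Icc 0 1)) (hf0 : f 0 = 0) (hf1 : f 1 = 1)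
    (hmatch : ∀ ξ ∈ Icc (0 : ℝ) 1, |τ (f ξ) - π ξ| ≤ δ)
    (hz₁ : 0 ≤ z₁) (hz₁x : z₁ ≤ x) (hxz₂ : x ≤ z₂) (hz₂ : z₂ ≤ 1)
    (hπ₁ : π z₁ = h) (hπ₂ : π z₂ = h)
    (hmid : ∀ ξ ∈ Icc z₁ z₂, π ξ ≤ π x ∧ h ≤ π ξ) (hmono : MonotoneOn π (Icc z₁ x))
    (hκ₁ : ∀ ξ ∈ Icc 0 z₁, κ ξ = π ξ) (hκ₂ : ∀ ξ ∈ Icc z₂ 1, κ ξ = π ξ)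
    (hκm : ∀ ξ ∈ Icc z₁ z₂, κ ξ = h) (hup : UpAt δ τ (π x) (f x)) :
    FreeReach τ κ (δ + η) (0, 0) (1, 1) := by
  obtain ⟨ys, ye, hys0, hysx, hxye, hye1, hback, hvu, huv, hstart, -⟩ := hup
  have hz₁₂ : z₁ ≤ z₂ := hz₁x.trans hxz₂
  have hx0 : 0 ≤ x := hz₁.trans hz₁x
  have hx1 : x ≤ 1 := hxz₂.trans hz₂
  have hm : ∀ ξ, 0 ≤ ξ → ξ ≤ 1 → π ξ - δ ≤ τ (f ξ) ∧ τ (f ξ) ≤ π ξ + δ := fun ξ h0 h1 => by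
    have := abs_le.1 (hmatch ξ ⟨h0, h1⟩)
    constructor <;> linarith
  have fmono : ∀ a b, 0 ≤ a → a ≤ b → b ≤ 1 → f a ≤ f b := fun a b ha hab hb =>
    hfm ⟨ha, hab.trans hb⟩ ⟨ha.trans hab, hb⟩ hab
  have surj : ∀ a b, 0 ≤ a → a ≤ b → b ≤ 1 → ∀ y, f a ≤ y → y ≤ f b → ∃ ξ, a ≤ ξ ∧ ξ ≤ b ∧ f ξ = y :=
    fun a b ha hab hb y hy hy' => by
      obtain ⟨ξ, hξ, hξy⟩ := intermediate_value_Icc hab (hf.mono (Icc_subset_Icc ha hb)) ⟨hy, hy'⟩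
      exact ⟨ξ, hξ.1, hξ.2, hξy⟩
  have f0 : ∀ a, 0 ≤ a → a ≤ 1 → 0 ≤ f a := fun a ha ha' => hf0 ▸ fmono 0 a le_rfl ha ha'
  have f1 : ∀ a, 0 ≤ a → a ≤ 1 → f a ≤ 1 := fun a ha ha' => hf1 ▸ fmono a 1 ha ha' le_rfl
  have pre : ∀ c, 0 ≤ c → c ≤ z₁ → FreeReach τ κ (δ + η) (0, 0) (f c, c) := fun c hc hcz => by
    have hc1 : c ≤ 1 := hcz.trans (hz₁₂.trans hz₂)
    have := FreeReach.of_matching (τ := τ) (π := κ) (f := f) (δ := δ) hη hc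
      (hf.mono (Icc_subset_Icc_right hc1)) (hfm.mono (Icc_subset_Icc_right hc1))
      ((hπ.mono (Icc_subset_Icc_right hc1)).congr fun ξ hξ => hκ₁ ξ ⟨hξ.1, hξ.2.trans hcz⟩)
      (fun ξ hξ => by
        rw [hκ₁ ξ ⟨hξ.1, hξ.2.trans hcz⟩]; exact hmatch ξ ⟨hξ.1, hξ.2.trans hc1⟩)
    rwa [hf0] at this
  have post : ∀ c, z₂ ≤ c → c ≤ 1 → FreeReach τ κ (δ + η) (f c, c) (1, 1) := fun c hcz hc => by
    have hc0 : 0 ≤ c := hx0.trans (hxz₂.trans hcz)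
    have := FreeReach.of_matching (τ := τ) (π := κ) (f := f) (δ := δ) hη hc
      (hf.mono (Icc_subset_Icc_left hc0)) (hfm.mono (Icc_subset_Icc_left hc0))
      ((hπ.mono (Icc_subset_Icc_left hc0)).congr fun ξ hξ => hκ₂ ξ ⟨hcz.trans hξ.1, hξ.2⟩)
      (fun ξ hξ => by
        rw [hκ₂ ξ ⟨hcz.trans hξ.1, hξ.2⟩]; exact hmatch ξ ⟨hc0.trans hξ.1, hξ.2⟩)
    rwa [hf1] at this
  obtain ⟨xe, hxe, hxe1, hfxe⟩ : ∃ xe, z₂ ≤ xe ∧ xe ≤ 1 ∧ f xe = ye := by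
    by_cases hle : f z₂ ≤ ye
    · exact surj z₂ 1 (hx0.trans hxz₂) hz₂ le_rfl ye hle (by rwa [hf1])
    · exfalso
      obtain ⟨ξ, h1, h2, rfl⟩ := surj x z₂ hx0 hxz₂ hz₂ ye hxye (not_le.1 hle).le
      have := (hm ξ (hx0.trans h1) (h2.trans hz₂)).2
      linarith [(hmid ξ ⟨hz₁x.trans h1, h2⟩).1]
  obtain ⟨xs, hxs0, hxsx, hfxs, hxs⟩ : ∃ xs, 0 ≤ xs ∧ xs ≤ x ∧ f xs = ys ∧ (ys = 0 → xs = 0) := by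
    by_cases h0 : ys = 0
    · exact ⟨0, le_rfl, hx0, by rw [hf0, h0], fun _ => rfl⟩
    · obtain ⟨ξ, h1, h2, h3⟩ := surj 0 x le_rfl hx0 hx1 ys (by rwa [hf0]) hysx
      exact ⟨ξ, h1, h2, h3, fun h => absurd h h0⟩
  have hxs1 : xs ≤ 1 := hxsx.trans hx1
  have hpre : ∀ ξ, z₁ ≤ ξ → ξ ≤ xs → π ξ ≤ τ ys + δ := fun ξ h1 h2 => by
    have h3 := hmono ⟨h1, h2.trans hxsx⟩ ⟨h1.trans h2, hxsx⟩ h2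
    have h4 := (hm xs hxs0 hxs1).1
    rw [hfxs] at h4
    linarith
  have hz₁1 : z₁ ≤ 1 := hz₁x.trans hx1
  have hz₂0 : 0 ≤ z₂ := hx0.trans hxz₂
  have hfz : f z₁ ≤ f z₂ := fmono z₁ z₂ hz₁ hz₁₂ hz₂
  obtain ⟨θ, hθ, hθmax⟩ := isCompact_Icc.exists_isMaxOn (nonempty_Icc.2 hfz)
    (hτ.mono (Icc_subset_Icc (f0 z₁ hz₁ hz₁1) (f1 z₂ hz₂0 hz₂)))
  have hmax : ∀ y, f z₁ ≤ y → y ≤ f z₂ → τ y ≤ τ θ := fun y h1 h2 => hθmax ⟨h1, h2⟩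
  have hmin : ∀ y, f z₁ ≤ y → y ≤ f z₂ → h - δ ≤ τ y := fun y h1 h2 => by
    obtain ⟨ξ, h3, h4, rfl⟩ := surj z₁ z₂ hz₁ hz₁₂ hz₂ y h1 h2
    linarith [(hm ξ (hz₁.trans h3) (h4.trans hz₂)).1, (hmid ξ ⟨h3, h4⟩).2]
  have hTu : τ θ ≤ π x + δ := by
    obtain ⟨ξ, h3, h4, h5⟩ := surj z₁ z₂ hz₁ hz₁₂ hz₂ θ hθ.1 hθ.2
    rw [← h5]
    linarith [(hm ξ (hz₁.trans h3) (h4.trans hz₂)).2, (hmid ξ ⟨h3, h4⟩).1]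
  have huT : π x - δ ≤ τ θ :=
    (hm x hx0 hx1).1.trans (hmax _ (fmono _ _ hz₁ hz₁x hx1) (fmono _ _ hx0 hxz₂ hz₂))
  by_cases hTh : τ θ ≤ h + δ
  · refine (pre z₁ hz₁ le_rfl).trans (FreeReach.trans (FreeReach.of_box hfz hz₁₂ ?_)
      (post z₂ le_rfl hz₂))
    intro y hy ξ hξ
    rw [hκm ξ hξ, abs_le]
    constructor <;> linarith [hmax y hy.1 hy.2, hmin y hy.1 hy.2]
  push Not at hTh
  obtain ⟨p, hp⟩ : ∃ p, p = τ θ - δ := ⟨_, rfl⟩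
  have hhp : h < p := by linarith
  have hπxe : π xe + δ ≥ τ ye := hfxe ▸ (hm xe (hz₂0.trans hxe) hxe1).2
  obtain ⟨xp, ⟨hxp, hxpe⟩, hπxp, hxpl⟩ := exists_first_hit_up (v := p) hxe
    (hπ.mono (Icc_subset_Icc hz₂0 hxe1)) (by linarith) (by linarith)
  have hxp1 : xp ≤ 1 := hxpe.trans hxe1
  have hxp0 : 0 ≤ xp := hz₂0.trans hxp
  have hθs : ys ≤ θ := by
    by_contra! hlt
    have hzs : z₁ ≤ xs := by
      by_contra! h1
      have := fmono xs z₁ hxs0 h1.le hz₁1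
      linarith [hθ.1]
    obtain ⟨ξ, h3, h4, h5⟩ := surj z₁ xs hz₁ hzs hxs1 θ hθ.1 (hfxs ▸ hlt.le)
    have := (hm ξ (hz₁.trans h3) (h4.trans hxs1)).2
    rw [h5] at this
    linarith [hpre ξ h3 h4]
  have hfe : ∀ ξ, 0 ≤ ξ → ξ ≤ xe → f ξ ≤ ye := fun ξ h1 h2 => hfxe ▸ fmono ξ xe h1 h2 hxe1
  have hθe : θ ≤ ye := hθ.2.trans (hfe z₂ hz₂0 hxe)
  obtain ⟨xμ, hxμ, hxμmin⟩ := isCompact_Icc.exists_isMinOn (nonempty_Icc.2 hxp)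
    (hπ.mono (Icc_subset_Icc hz₂0 hxp1))
  obtain ⟨μ, hμ⟩ : ∃ μ, μ = π xμ := ⟨_, rfl⟩
  have hμle : ∀ ξ, z₂ ≤ ξ → ξ ≤ xp → μ ≤ π ξ := fun ξ h1 h2 => hμ ▸ hxμmin ⟨h1, h2⟩
  have hμh : μ ≤ h := hπ₂ ▸ hμle z₂ le_rfl hxp
  have hxμ0 : 0 ≤ xμ := hz₂0.trans hxμ.1
  have hpμ : p - 2 * δ ≤ μ := by
    have h1 := hback θ (f xμ) hθs (hθ.2.trans (fmono _ _ hz₂0 hxμ.1 (hxμ.2.trans hxp1)))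
      (hfe xμ hxμ0 (hxμ.2.trans hxpe))
    linarith [(hm xμ hxμ0 (hxμ.2.trans hxp1)).2]
  have hvμ : τ ys ≤ μ + δ := by linarith
  have hτxμ : τ (f xμ) ≤ μ + δ := by
    rw [hμ]; exact (hm xμ hxμ0 (hxμ.2.trans hxp1)).2
  have hfxp : f xp ≤ ye := hfe xp hxp0 hxpe
  have hθxp : θ ≤ f xp := hθ.2.trans (fmono _ _ hz₂0 hxp hxp1)
  -- the values of both curves after a stretch on which `π` stays in `[μ, p]`
  have hτr : ∀ x0, 0 ≤ x0 → x0 ≤ z₁ → (∀ ξ ∈ Icc x0 z₁, π ξ ∈ Icc μ p) →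
      ∀ y, f x0 ≤ y → y ≤ f xp → τ y ∈ Icc (μ - δ) (p + δ) := by
    intro x0 h0 h0z hst y h1 h2
    obtain ⟨ξ, h3, h4, rfl⟩ := surj x0 xp h0 (h0z.trans (hz₁₂.trans hxp)) hxp1 y h1 h2
    have h5 := hm ξ (h0.trans h3) (h4.trans hxp1)
    rcases le_total ξ z₁ with h6 | h6
    · have := hst ξ ⟨h3, h6⟩
      constructor <;> linarith [this.1, this.2]
    rcases le_total ξ z₂ with h7 | h7
    · have h8 := hmax (f ξ) (fmono _ _ hz₁ h6 (h4.trans hxp1)) (fmono _ _ (hz₁.trans h6) h7 hz₂)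
      have h9 := (hmid ξ ⟨h6, h7⟩).2
      constructor <;> linarith
    · have h8 := hμle ξ h7 h4
      have h9 := hxpl ξ ⟨h7, h4⟩
      constructor <;> linarith
  have hκr : ∀ x0, 0 ≤ x0 → (∀ ξ ∈ Icc x0 z₁, π ξ ∈ Icc μ p) →
      ∀ ξ, x0 ≤ ξ → ξ ≤ xp → κ ξ ∈ Icc μ p := by
    intro x0 h0 hst ξ h1 h2
    rcases le_total ξ z₁ with h6 | h6
    · rw [hκ₁ ξ ⟨h0.trans h1, h6⟩]; exact hst ξ ⟨h1, h6⟩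
    rcases le_total ξ z₂ with h7 | h7
    · rw [hκm ξ ⟨h6, h7⟩]; exact ⟨hμh, hhp.le⟩
    · rw [hκ₂ ξ ⟨h7, h2.trans hxp1⟩]; exact ⟨hμle ξ h7 h2, hxpl ξ ⟨h7, h2⟩⟩
  have hfin : ∀ x0, 0 ≤ x0 → x0 ≤ z₁ → (∀ ξ ∈ Icc x0 z₁, π ξ ∈ Icc μ p) →
      (∀ a b, f x0 ≤ a → a ≤ b → b ≤ ye → τ a - τ b ≤ 2 * δ) →
      ∀ xc yV, x0 ≤ xc → xc ≤ z₁ → f x0 ≤ yV → yV ≤ θ → p - δ ≤ τ yV → τ yV ≤ μ + δ →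
      FreeReach τ κ (δ + η) (0, 0) (yV, xc) → FreeReach τ κ (δ + η) (0, 0) (1, 1) := by
    intro x0 h0 h0z hst hbk xc yV hxc hxcz hyV hyVθ hV1 hV2 hreach
    refine hreach.trans (FreeReach.trans (q := (yV, z₂))
      (FreeReach.of_box le_rfl (hxcz.trans hz₁₂) ?_)
      (FreeReach.trans (q := (f xp, xp)) ?_ (post xp hxp hxp1)))
    · intro y hy ξ hξ
      rw [le_antisymm hy.2 hy.1, abs_le]
      have := hκr x0 h0 hst ξ (hxc.trans hξ.1) (hξ.2.trans hxp)
      constructor <;> linarith [this.1, this.2]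
    · have hfx0 := f0 x0 h0 (h0z.trans hz₁1)
      refine FreeReach.of_sweep (θ := θ) (ξ := xμ) (μ := μ) (p := p) hη
        (hτ.mono (Icc_subset_Icc (hfx0.trans hyV) (f1 xp hxp0 hxp1)))
        ((hπ.mono (Icc_subset_Icc hz₂0 hxp1)).congr fun ξ hξ => hκ₂ ξ ⟨hξ.1, hξ.2.trans hxp1⟩)
        ⟨hyVθ, hθxp⟩ hxμ (by linarith) ?_ ?_ (fun ξ hξ => hκr z₁ hz₁ (fun ξ hξ => ?_) ξ
          (hz₁₂.trans hξ.1) hξ.2) (fun y hy => hτr x0 h0 h0z hst y (hyV.trans hy.1) hy.2)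
        (fun a b h1 h2 h3 => hbk a b (hyV.trans h1) h2 (h3.trans hfxp)) ⟨hV1, hV2⟩
      · rw [hκ₂ xμ ⟨hxμ.1, hxμ.2.trans hxp1⟩, hμ]
      · rw [hκ₂ xp ⟨hxp, hxp1⟩, hπxp]
      · rw [le_antisymm hξ.2 hξ.1, hπ₁]; exact ⟨hμh, hhp.le⟩
  have preA : ∀ x0, 0 ≤ x0 → x0 ≤ z₁ → (∀ ξ ∈ Icc x0 z₁, π ξ ∈ Icc μ p) →
      (∀ a b, f x0 ≤ a → a ≤ b → b ≤ ye → τ a - τ b ≤ 2 * δ) → τ (f x0) ≤ μ + δ →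
      FreeReach τ κ (δ + η) (0, 0) (1, 1) := by
    intro x0 h0 h0z hst hbk hτ0
    have hx0z := fmono x0 z₁ h0 h0z hz₁1
    rcases le_total (p - δ) (τ (f x0)) with hc | hc
    · exact hfin x0 h0 h0z hst hbk x0 (f x0) le_rfl h0z le_rfl (hx0z.trans hθ.1) hc hτ0
        (pre x0 h0 h0z)
    obtain ⟨yV, ⟨hyV0, hyVθ⟩, hyV, hyVl⟩ := exists_first_hit_up (v := p - δ) (hx0z.trans hθ.1)
      (hτ.mono (Icc_subset_Icc (f0 x0 h0 (h0z.trans hz₁1))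
        (hθ.2.trans (f1 z₂ hz₂0 hz₂)))) hc (by linarith)
    rcases le_total yV (f z₁) with hc' | hc'
    · obtain ⟨ξ, h1, h2, rfl⟩ := surj x0 z₁ h0 h0z hz₁1 yV hyV0 hc'
      exact hfin x0 h0 h0z hst hbk ξ (f ξ) h1 h2 hyV0 hyVθ hyV.ge (by linarith)
        (pre ξ (h0.trans h1) h2)
    · refine hfin x0 h0 h0z hst hbk z₁ yV h0z le_rfl hyV0 hyVθ hyV.ge (by linarith)
        ((pre z₁ hz₁ le_rfl).trans (FreeReach.of_box hc' le_rfl ?_))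
      intro y hy ξ hξ
      rw [hκm ξ ⟨hξ.1, hξ.2.trans hz₁₂⟩, abs_le]
      have h1 := hmin y hy.1 (hy.2.trans (hyVθ.trans hθ.2))
      have h2 := hyVl y ⟨hx0z.trans hy.1, hy.2⟩
      constructor <;> linarith
  have preB : ∀ x0, 0 ≤ x0 → x0 ≤ z₁ → (∀ ξ ∈ Icc x0 z₁, π ξ ∈ Icc μ p) →
      (∀ a b, f x0 ≤ a → a ≤ b → b ≤ ye → τ a - τ b ≤ 2 * δ) → π x0 = p →
      FreeReach τ κ (δ + η) (0, 0) (1, 1) := by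
    intro x0 h0 h0z hst hbk hp0
    have h01 := h0z.trans hz₁1
    have hx0z := fmono x0 z₁ h0 h0z hz₁1
    have h1 := hm x0 h0 h01
    rcases le_total (τ (f x0)) (μ + δ) with hc | hc
    · exact hfin x0 h0 h0z hst hbk x0 (f x0) le_rfl h0z le_rfl (hx0z.trans hθ.1)
        (by linarith) hc (pre x0 h0 h0z)
    have hx0μ : f x0 ≤ f xμ := fmono _ _ h0 (h0z.trans (hz₁₂.trans hxμ.1)) (hxμ.2.trans hxp1)
    obtain ⟨yV, ⟨hyV0, hyVμ⟩, hyV, hyVl⟩ := exists_first_hit_down (v := μ + δ) hx0μ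
      (hτ.mono (Icc_subset_Icc (f0 x0 h0 h01) (f1 xμ hxμ0 (hxμ.2.trans hxp1)))) hc hτxμ
    have hyVp : yV ≤ f xp := hyVμ.trans (fmono _ _ hxμ0 hxμ.2 hxp1)
    have hreach : FreeReach τ κ (δ + η) (0, 0) (yV, x0) := by
      refine (pre x0 h0 h0z).trans (FreeReach.of_box hyV0 le_rfl ?_)
      intro y hy ξ hξ
      rw [le_antisymm hξ.2 hξ.1, hκ₁ x0 ⟨h0, h0z⟩, hp0, abs_le]
      have h2 := hyVl y hy
      have h3 := (hτr x0 h0 h0z hst y hy.1 (hy.2.trans hyVp)).2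
      constructor <;> linarith
    rcases le_total yV θ with hc' | hc'
    · exact hfin x0 h0 h0z hst hbk x0 yV le_rfl h0z hyV0 hc' (by linarith) hyV.le hreach
    · refine hreach.trans (FreeReach.trans (q := (yV, xp))
        (FreeReach.of_box le_rfl (h0z.trans (hz₁₂.trans hxp)) ?_)
        (FreeReach.trans (FreeReach.of_box hyVp le_rfl ?_) (post xp hxp hxp1)))
      · intro y hy ξ hξ
        rw [le_antisymm hy.2 hy.1, hyV, abs_le]
        have := hκr x0 h0 hst ξ hξ.1 hξ.2
        constructor <;> linarith [this.1, this.2]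
      · intro y hy ξ hξ
        rw [le_antisymm hξ.2 hξ.1, hκ₂ xp ⟨hxp, hxp1⟩, hπxp, abs_le]
        have h2 := hback θ y hθs (hc'.trans hy.1) (hy.2.trans hfxp)
        have h3 := (hτr x0 h0 h0z hst y (hyV0.trans hy.1) hy.2).2
        constructor <;> linarith
  have hhμp : π z₁ ∈ Icc μ p := by rw [hπ₁]; exact ⟨hμh, hhp.le⟩
  rcases le_or_gt xs z₁ with hsz | hsz
  · obtain ⟨x0, ⟨h1, h2⟩, hst, hcase⟩ := exists_last_stay hsz
      (hπ.mono (Icc_subset_Icc hxs0 hz₁1)) hhμp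
    have h0 := hxs0.trans h1
    have hbk : ∀ a b, f x0 ≤ a → a ≤ b → b ≤ ye → τ a - τ b ≤ 2 * δ := fun a b h3 =>
      hback a b ((hfxs ▸ fmono _ _ hxs0 h1 (h2.trans hz₁1)).trans h3)
    rcases hcase with rfl | hc | hc
    · exact preA x0 h0 h2 hst hbk (by rwa [hfxs])
    · exact preA x0 h0 h2 hst hbk (hc ▸ (hm x0 h0 (h2.trans hz₁1)).2)
    · exact preB x0 h0 h2 hst hbk hc
  · have hhv : h ≤ τ ys + δ := hπ₁ ▸ hpre z₁ le_rfl hsz.le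
    rcases hstart with hs | hs | ⟨z, hz0, hzs, hzmin, hzhigh⟩
    · linarith [hxs hs]
    · linarith
    obtain ⟨xz, hxz0, hxzs, rfl⟩ := surj 0 xs le_rfl hxs0 hxs1 z (by rwa [hf0]) (by rwa [hfxs])
    have h1 := (hm xz hxz0 (hxzs.trans hxs1)).2
    have hxzz : xz ≤ z₁ := by
      by_contra! hlt
      linarith [hpre xz hlt.le hxzs]
    obtain ⟨xw, ⟨hxzw, hxwz⟩, hπw, hwl⟩ := exists_last_hit_down (v := τ ys + δ) hxzz
      (hπ.mono (Icc_subset_Icc hxz0 hz₁1)) (by linarith) (by rwa [hπ₁])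
    have hxw0 := hxz0.trans hxzw
    have hzw : f xz ≤ f xw := fmono _ _ hxz0 hxzw (hxwz.trans hz₁1)
    have hτlow : ∀ y, f xw ≤ y → y ≤ ys → τ y ≤ τ ys + 2 * δ := by
      intro y h3 h4
      obtain ⟨ξ, h5, h6, rfl⟩ := surj xw xs hxw0 (hxwz.trans hsz.le) hxs1 y h3 (by rwa [hfxs])
      have h7 := (hm ξ (hxw0.trans h5) (h6.trans hxs1)).2
      rcases le_total ξ z₁ with h8 | h8
      · linarith [hwl ξ ⟨h5, h8⟩]
      · linarith [hpre ξ h8 h6]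
    have hbk' : ∀ a b, f xw ≤ a → a ≤ b → b ≤ ye → τ a - τ b ≤ 2 * δ := by
      intro a b h3 h4 h5
      rcases le_total ys a with h6 | h6
      · exact hback a b h6 h4 h5
      · linarith [hτlow a h3 h6, hzmin b ⟨hzw.trans (h3.trans h4), h5⟩]
    obtain ⟨x0, ⟨h2, h3⟩, hst, hcase⟩ := exists_last_stay hxwz
      (hπ.mono (Icc_subset_Icc hxw0 hz₁1)) hhμp
    have h0 := hxw0.trans h2
    have hbk : ∀ a b, f x0 ≤ a → a ≤ b → b ≤ ye → τ a - τ b ≤ 2 * δ := fun a b h4 =>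
      hbk' a b ((fmono _ _ hxw0 h2 (h3.trans hz₁1)).trans h4)
    rcases hcase with rfl | hc | hc
    · have hws : f x0 ≤ ys := hfxs ▸ fmono _ _ h0 (h3.trans hsz.le) hxs1
      obtain ⟨yV, hyVs, hyVθ, hV1, hV2, hVl⟩ : ∃ yV, ys ≤ yV ∧ yV ≤ θ ∧ p - δ ≤ τ yV ∧
          τ yV ≤ μ + δ ∧ ∀ y, ys ≤ y → y ≤ yV → τ y ≤ τ ys + 2 * δ := by
        rcases le_total (p - δ) (τ ys) with hc | hc
        · refine ⟨ys, le_rfl, hθs, hc, hvμ, fun y h4 h5 => ?_⟩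
          rw [le_antisymm h5 h4]
          linarith
        · obtain ⟨yV, ⟨hyV0, hyVθ⟩, hyV, hyVl⟩ := exists_first_hit_up (v := p - δ) hθs
            (hτ.mono (Icc_subset_Icc hys0 (hθe.trans hye1))) hc (by linarith)
          exact ⟨yV, hyV0, hyVθ, hyV.ge, by linarith,
            fun y h4 h5 => (hyVl y ⟨h4, h5⟩).trans (by linarith)⟩
      refine hfin x0 h0 h3 hst hbk x0 yV le_rfl h3 (hws.trans hyVs) hyVθ hV1 hV2
        ((pre x0 h0 h3).trans (FreeReach.of_box (hws.trans hyVs) le_rfl ?_))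
      intro y hy ξ hξ
      rw [le_antisymm hξ.2 hξ.1, hκ₁ x0 ⟨h0, h3⟩, hπw, abs_le]
      have h4 := hzmin y ⟨hzw.trans hy.1, hy.2.trans (hyVθ.trans hθe)⟩
      have h5 : τ y ≤ τ ys + 2 * δ := by
        rcases le_total y ys with h6 | h6
        · exact hτlow y hy.1 h6
        · exact hVl y h6 hy.2
      constructor <;> linarith
    · exact preA x0 h0 h3 hst hbk (hc ▸ (hm x0 h0 (h3.trans hz₁1)).2)
    · exact preB x0 h0 h3 hst hbk hc

lemma UpAt.reverse {δ u y : ℝ} {τ : ℝ → ℝ} (h : UpAt δ τ u y) :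
    UpAt δ (fun a => -τ (1 - a)) (-u) (1 - y) := by
  obtain ⟨ys, ye, hys0, hysy, hyye, hye1, hback, hvu, huv, hstart, hend⟩ := h
  refine ⟨1 - ye, 1 - ys, by linarith, by linarith, by linarith, by linarith, fun a b h1 h2 h3 => ?_,
    by simp only [sub_sub_cancel]; linarith, by simp only [sub_sub_cancel]; linarith, ?_, ?_⟩
  · have := hback (1 - b) (1 - a) (by linarith) (by linarith) (by linarith)
    linarith
  · simp only [sub_sub_cancel]
    rcases hend with h | h | ⟨z, h1, h2, h3, h4⟩
    · exact Or.inl (by linarith)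
    · exact Or.inr (Or.inl (by linarith))
    · refine Or.inr (Or.inr ⟨1 - z, by linarith, by linarith, fun a ha => ?_, ?_⟩)
      · exact neg_le_neg (h3 _ ⟨by linarith [ha.2], by linarith [ha.1]⟩)
      · simp only [sub_sub_cancel]; linarith
  · simp only [sub_sub_cancel]
    rcases hstart with h | h | ⟨z, h1, h2, h3, h4⟩
    · exact Or.inl (by linarith)
    · exact Or.inr (Or.inl (by linarith))
    · refine Or.inr (Or.inr ⟨1 - z, by linarith, by linarith, fun a ha => ?_, ?_⟩)
      · exact neg_le_neg (h3 _ ⟨by linarith [ha.2], by linarith [ha.1]⟩)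
      · simp only [sub_sub_cancel]; linarith

/-- Replacing a local maximum of the second curve by a plateau preserves the matching if the first
curve is rising there. -/
lemma FreeReach.of_cut_max {τ π f κ : ℝ → ℝ} {δ η a x b : ℝ} (hδ : 0 < δ) (hη : 0 < η)
    (hτ : ContinuousOn τ (Icc 0 1)) (hπ : ContinuousOn π (Icc 0 1))
    (hf : ContinuousOn f (Icc 0 1)) (hfm : MonotoneOn f (Icc 0 1)) (hf0 : f 0 = 0) (hf1 : f 1 = 1)
    (hmatch : ∀ ξ ∈ Icc (0 : ℝ) 1, |τ (f ξ) - π ξ| ≤ δ)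
    (ha : 0 ≤ a) (hax : a ≤ x) (hxb : x ≤ b) (hb : b ≤ 1)
    (hmono : MonotoneOn π (Icc a x)) (hanti : AntitoneOn π (Icc x b))
    (hlt : max (π a) (π b) < π x)
    (hκ : ∀ ξ ∈ Icc a b, κ ξ = min (π ξ) (max (π a) (π b)))
    (hκ' : ∀ ξ ∈ Icc (0 : ℝ) 1, ξ ≤ a ∨ b ≤ ξ → κ ξ = π ξ) (hup : UpAt δ τ (π x) (f x)) :
    FreeReach τ κ (δ + η) (0, 0) (1, 1) := by
  obtain ⟨z₁, hz₁, hπ₁⟩ := intermediate_value_Icc hax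
    (hπ.mono (Icc_subset_Icc ha (hxb.trans hb))) ⟨le_max_left (π a) (π b), hlt.le⟩
  obtain ⟨z₂, hz₂, hπ₂⟩ := intermediate_value_Icc' hxb
    (hπ.mono (Icc_subset_Icc (ha.trans hax) hb)) ⟨le_max_right (π a) (π b), hlt.le⟩
  have hx₁ : x ∈ Icc a x := ⟨hax, le_rfl⟩
  have hx₂ : x ∈ Icc x b := ⟨le_rfl, hxb⟩
  refine FreeReach.of_cut (h := max (π a) (π b)) hδ hη hτ hπ hf hfm hf0 hf1 hmatch
    (ha.trans hz₁.1) hz₁.2 hz₂.1 (hz₂.2.trans hb) hπ₁ hπ₂ ?_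
    (hmono.mono (Icc_subset_Icc_left hz₁.1)) ?_ ?_ ?_ hup
  · rintro ξ ⟨h1, h2⟩
    rcases le_total ξ x with h | h
    · exact ⟨hmono ⟨hz₁.1.trans h1, h⟩ hx₁ h, hπ₁ ▸ hmono hz₁ ⟨hz₁.1.trans h1, h⟩ h1⟩
    · exact ⟨hanti hx₂ ⟨h, h2.trans hz₂.2⟩ h, hπ₂ ▸ hanti ⟨h, h2.trans hz₂.2⟩ hz₂ h2⟩
  · rintro ξ ⟨h1, h2⟩
    rcases le_total ξ a with h | h
    · exact hκ' ξ ⟨h1, h.trans (hax.trans (hxb.trans hb))⟩ (Or.inl h)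
    · rw [hκ ξ ⟨h, h2.trans (hz₁.2.trans hxb)⟩, min_eq_left]
      exact (hmono ⟨h, h2.trans hz₁.2⟩ hz₁ h2).trans_eq hπ₁
  · rintro ξ ⟨h1, h2⟩
    rcases le_total b ξ with h | h
    · exact hκ' ξ ⟨(ha.trans (hax.trans hxb)).trans h, h2⟩ (Or.inr h)
    · rw [hκ ξ ⟨hax.trans (hz₂.1.trans h1), h⟩, min_eq_left]
      exact (hanti hz₂ ⟨hz₂.1.trans h1, h⟩ h1).trans_eq hπ₂
  · rintro ξ ⟨h1, h2⟩
    rw [hκ ξ ⟨hz₁.1.trans h1, h2.trans hz₂.2⟩, min_eq_right]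
    rcases le_total ξ x with h | h
    · exact hπ₁.symm.trans_le (hmono hz₁ ⟨hz₁.1.trans h1, h⟩ h1)
    · exact hπ₂.symm.trans_le (hanti ⟨h, h2.trans hz₂.2⟩ hz₂ h2)

/-- Replacing a local minimum of the second curve by a plateau preserves the matching if the first
curve is rising there. -/
lemma FreeReach.of_cut_min {τ π f κ : ℝ → ℝ} {δ η a x b : ℝ} (hδ : 0 < δ) (hη : 0 < η)
    (hτ : ContinuousOn τ (Icc 0 1)) (hπ : ContinuousOn π (Icc 0 1))
    (hf : ContinuousOn f (Icc 0 1)) (hfm : MonotoneOn f (Icc 0 1)) (hf0 : f 0 = 0) (hf1 : f 1 = 1)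
    (hmatch : ∀ ξ ∈ Icc (0 : ℝ) 1, |τ (f ξ) - π ξ| ≤ δ)
    (ha : 0 ≤ a) (hax : a ≤ x) (hxb : x ≤ b) (hb : b ≤ 1)
    (hanti : AntitoneOn π (Icc a x)) (hmono : MonotoneOn π (Icc x b))
    (hlt : π x < min (π a) (π b))
    (hκ : ∀ ξ ∈ Icc a b, κ ξ = max (π ξ) (min (π a) (π b)))
    (hκ' : ∀ ξ ∈ Icc (0 : ℝ) 1, ξ ≤ a ∨ b ≤ ξ → κ ξ = π ξ) (hup : UpAt δ τ (π x) (f x)) :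
    FreeReach τ κ (δ + η) (0, 0) (1, 1) := by
  have hrc : ContinuousOn (fun y : ℝ => 1 - y) (Icc 0 1) := by fun_prop
  have hrm : MapsTo (fun y : ℝ => 1 - y) (Icc 0 1) (Icc 0 1) :=
    fun y hy => ⟨by linarith [hy.2], by linarith [hy.1]⟩
  have := (FreeReach.of_cut_max (τ := fun y => -τ (1 - y)) (π := fun ξ => -π (1 - ξ))
    (f := fun ξ => 1 - f (1 - ξ)) (κ := fun ξ => -κ (1 - ξ)) (a := 1 - b) (x := 1 - x)
    (b := 1 - a) hδ hη (hτ.comp hrc hrm).neg (hπ.comp hrc hrm).neg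
    (continuousOn_const.sub (hf.comp hrc hrm))
    (fun y hy z hz h => sub_le_sub_left (hfm (hrm hz) (hrm hy) (by linarith)) _)
    (by simp [hf1]) (by simp [hf0])
    (fun ξ hξ => by
      have := hmatch (1 - ξ) (hrm hξ)
      rwa [sub_sub_cancel, ← neg_sub', abs_neg])
    (by linarith) (by linarith) (by linarith) (by linarith)
    (fun y hy z hz h => neg_le_neg (hmono ⟨by linarith [hz.2], by linarith [hz.1]⟩
      ⟨by linarith [hy.2], by linarith [hy.1]⟩ (by linarith)))
    (fun y hy z hz h => neg_le_neg (hanti ⟨by linarith [hz.2], by linarith [hz.1]⟩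
      ⟨by linarith [hy.2], by linarith [hy.1]⟩ (by linarith)))
    (by simp only [sub_sub_cancel]; rw [max_neg_neg, min_comm]; exact neg_lt_neg hlt)
    (fun ξ hξ => by
      simp only [sub_sub_cancel]
      rw [hκ _ ⟨by linarith [hξ.2], by linarith [hξ.1]⟩, max_neg_neg, min_neg_neg,
        min_comm (π b)])
    (fun ξ hξ h => by
      rw [hκ' _ (hrm hξ) (by rcases h with h | h <;> [right; left] <;> linarith)])
    (by simpa only [sub_sub_cancel] using hup.reverse)).reverse.neg
  simpa using this

/-- Replacing a local maximum of the second curve by a plateau preserves the matching if the first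
curve is rising or falling there. -/
lemma FreeReach.of_cut_max' {τ π f κ : ℝ → ℝ} {δ η a x b : ℝ} (hδ : 0 < δ) (hη : 0 < η)
    (hτ : ContinuousOn τ (Icc 0 1)) (hπ : ContinuousOn π (Icc 0 1))
    (hf : ContinuousOn f (Icc 0 1)) (hfm : MonotoneOn f (Icc 0 1)) (hf0 : f 0 = 0) (hf1 : f 1 = 1)
    (hmatch : ∀ ξ ∈ Icc (0 : ℝ) 1, |τ (f ξ) - π ξ| ≤ δ)
    (ha : 0 ≤ a) (hax : a ≤ x) (hxb : x ≤ b) (hb : b ≤ 1)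
    (hmono : MonotoneOn π (Icc a x)) (hanti : AntitoneOn π (Icc x b))
    (hlt : max (π a) (π b) < π x)
    (hκ : ∀ ξ ∈ Icc a b, κ ξ = min (π ξ) (max (π a) (π b)))
    (hκ' : ∀ ξ ∈ Icc (0 : ℝ) 1, ξ ≤ a ∨ b ≤ ξ → κ ξ = π ξ)
    (hup : UpAt δ τ (π x) (f x) ∨ UpAt δ (fun y => -τ y) (-π x) (f x)) :
    FreeReach τ κ (δ + η) (0, 0) (1, 1) := by
  rcases hup with hup | hup
  · exact FreeReach.of_cut_max hδ hη hτ hπ hf hfm hf0 hf1 hmatch ha hax hxb hb hmono hanti hlt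
      hκ hκ' hup
  · have := (FreeReach.of_cut_min (τ := fun y => -τ y) (π := fun ξ => -π ξ) (κ := fun ξ => -κ ξ)
      hδ hη hτ.neg hπ.neg hf hfm hf0 hf1
      (fun ξ hξ => by rw [← neg_sub', abs_neg]; exact hmatch ξ hξ) ha hax hxb hb
      hmono.neg hanti.neg (by rw [min_neg_neg]; exact neg_lt_neg hlt)
      (fun ξ hξ => by rw [hκ ξ hξ, min_neg_neg, max_neg_neg])
      (fun ξ hξ h => by rw [hκ' ξ hξ h]) hup).neg
    simpa using this

/-- Straightening a monotone stretch of the second curve preserves reachability. -/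
lemma FreeReach.of_straighten {τ κ π : ℝ → ℝ} {ε a b u v : ℝ} (ha : 0 ≤ a) (hab : a < b)
    (hb : b ≤ 1) (hκc : ContinuousOn κ (Icc a b))
    (hκm : MonotoneOn κ (Icc a b) ∨ AntitoneOn κ (Icc a b))
    (hmid : ∀ ξ ∈ Icc a b, π ξ = u + (ξ - a) / (b - a) * (v - u))
    (hout : ∀ ξ ∈ Icc (0 : ℝ) 1, ξ ≤ a ∨ b ≤ ξ → κ ξ = π ξ)
    (h : FreeReach τ κ ε (0, 0) (1, 1)) : FreeReach τ π ε (0, 0) (1, 1) := by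
  have hba : b - a ≠ 0 := (sub_pos.2 hab).ne'
  have hma : a ∈ Icc a b := ⟨le_rfl, hab.le⟩
  have hmb : b ∈ Icc a b := ⟨hab.le, le_rfl⟩
  have hκa : κ a = u := by
    rw [hout a ⟨ha, hab.le.trans hb⟩ (Or.inl le_rfl), hmid a hma]; simp
  have hκb : κ b = v := by
    rw [hout b ⟨ha.trans hab.le, hb⟩ (Or.inr le_rfl), hmid b hmb, div_self hba]; ring
  by_cases huv : u = v
  · have hκ : ∀ ξ ∈ Icc (0 : ℝ) 1, κ ξ = π ξ := by
      intro ξ hξ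
      by_cases hin : ξ ∈ Icc a b
      · rw [hmid ξ hin, huv, sub_self, mul_zero, add_zero]
        rcases hκm with hκm | hκm
        · have h1 := hκm hma hin hin.1
          have h2 := hκm hin hmb hin.2
          linarith
        · have h1 := hκm hma hin hin.1
          have h2 := hκm hin hmb hin.2
          linarith
      · refine hout ξ hξ ?_
        by_contra! hc
        exact hin ⟨hc.1.le, hc.2.le⟩
    exact (FreeReach.of_comp (φ := id) continuousOn_id monotoneOn_id hκ h le_rfl le_rfl).1
  have hvu : v - u ≠ 0 := sub_ne_zero.2 (Ne.symm huv)
  set P : ℝ → ℝ := fun ξ => max a (min ξ b) with hP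
  have hPm : ∀ ξ, P ξ ∈ Icc a b := fun ξ => ⟨le_max_left _ _, max_le hab.le (min_le_right _ _)⟩
  set g : ℝ → ℝ := fun ξ => (κ ξ - u) / (v - u) with hg
  have hgm : MonotoneOn g (Icc a b) := by
    intro y hy z hz hyz
    rcases lt_or_gt_of_ne huv with hlt | hlt
    · have hmono : κ y ≤ κ z := by
        rcases hκm with hκm | hκm
        · exact hκm hy hz hyz
        · linarith [hκm hma hmb hab.le]
      exact div_le_div_of_nonneg_right (by linarith) (by linarith)
    · have hanti : κ z ≤ κ y := by
        rcases hκm with hκm | hκm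
        · linarith [hκm hma hmb hab.le]
        · exact hκm hy hz hyz
      exact div_le_div_of_nonpos_of_le (by linarith) (by linarith)
  set φ : ℝ → ℝ := fun ξ => a + g (P ξ) * (b - a) + (min ξ a - a) + (max ξ b - b) with hφ
  have hφa : ∀ ξ, ξ ≤ a → φ ξ = ξ := fun ξ hξ => by
    have h1 : P ξ = a := by
      simp only [hP]; rw [min_eq_left (hξ.trans hab.le), max_eq_left hξ]
    simp only [hφ, h1, hg, hκa, min_eq_left hξ, max_eq_right (hξ.trans hab.le)]
    simp
  have hφb : ∀ ξ, b ≤ ξ → φ ξ = ξ := fun ξ hξ => by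
    have h1 : P ξ = b := by
      simp only [hP]; rw [min_eq_right hξ, max_eq_right hab.le]
    simp only [hφ, h1, hg, hκb, min_eq_right (hab.le.trans hξ), max_eq_left hξ, div_self hvu]
    ring
  have hga : g a = 0 := by simp [hg, hκa]
  have hgb : g b = 1 := by simp only [hg, hκb, div_self hvu]
  have hφmid : ∀ ξ ∈ Icc a b, φ ξ ∈ Icc a b ∧ κ ξ = π (φ ξ) := by
    intro ξ hξ
    have h1 : P ξ = ξ := by
      simp only [hP]; rw [min_eq_left hξ.2, max_eq_right hξ.1]
    have h2 : φ ξ = a + g ξ * (b - a) := by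
      simp only [hφ, h1, min_eq_right hξ.1, max_eq_right hξ.2]; ring
    have h3 : 0 ≤ g ξ := hga ▸ hgm hma hξ hξ.1
    have h4 : g ξ ≤ 1 := hgb ▸ hgm hξ hmb hξ.2
    have h5 : φ ξ ∈ Icc a b := by
      rw [h2]; constructor <;> nlinarith
    refine ⟨h5, ?_⟩
    rw [hmid _ h5, h2, add_sub_cancel_left, mul_div_cancel_right₀ _ hba]
    simp only [hg]
    rw [div_mul_cancel₀ _ hvu]; ring
  have hPc : ContinuousOn P (Icc 0 1) := by fun_prop
  have hPmono : Monotone P := fun y z hyz => max_le_max le_rfl (min_le_min hyz le_rfl)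
  have hgc : ContinuousOn g (Icc a b) := (hκc.sub continuousOn_const).div_const _
  have hφc : ContinuousOn φ (Icc 0 1) :=
    (((continuousOn_const.add ((hgc.comp hPc fun ξ _ => hPm ξ).mul continuousOn_const)).add
      (by fun_prop)).add (by fun_prop))
  have hφm : MonotoneOn φ (Icc 0 1) := fun y _ z _ hyz => by
    have h1 := mul_le_mul_of_nonneg_right (hgm (hPm y) (hPm z) (hPmono hyz))
      (sub_pos.2 hab).le
    have h2 : min y a ≤ min z a := min_le_min hyz le_rfl
    have h3 : max y b ≤ max z b := max_le_max hyz le_rfl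
    simp only [hφ]
    linarith
  have := (FreeReach.of_comp hφc hφm (π := π) (fun ξ hξ => ?_) h le_rfl le_rfl).1
  · simpa only [hφa 0 ha, hφb 1 hb] using this
  · rcases le_total ξ a with h1 | h1
    · rw [hφa ξ h1, hout ξ hξ (Or.inl h1)]
    rcases le_total ξ b with h2 | h2
    · exact (hφmid ξ ⟨h1, h2⟩).2
    · rw [hφb ξ h2, hout ξ hξ (Or.inr h2)]

lemma FreeReach.of_shortcut_max {τ π π' f : ℝ → ℝ} {δ η a x b : ℝ} (hδ : 0 < δ) (hη : 0 < η)
    (hτ : ContinuousOn τ (Icc 0 1)) (hπ : ContinuousOn π (Icc 0 1))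
    (hf : ContinuousOn f (Icc 0 1)) (hfm : MonotoneOn f (Icc 0 1)) (hf0 : f 0 = 0) (hf1 : f 1 = 1)
    (hmatch : ∀ ξ ∈ Icc (0 : ℝ) 1, |τ (f ξ) - π ξ| ≤ δ)
    (ha : 0 ≤ a) (hax : a < x) (hxb : x < b) (hb : b ≤ 1)
    (hmono : MonotoneOn π (Icc a x)) (hanti : AntitoneOn π (Icc x b))
    (hlt : max (π a) (π b) < π x)
    (hmid : ∀ ξ ∈ Icc a b, π' ξ = π a + (ξ - a) / (b - a) * (π b - π a))
    (hout : ∀ ξ ∈ Icc (0 : ℝ) 1, ξ ≤ a ∨ b ≤ ξ → π' ξ = π ξ)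
    (hup : UpAt δ τ (π x) (f x) ∨ UpAt δ (fun y => -τ y) (-π x) (f x)) :
    FreeReach τ π' (δ + η) (0, 0) (1, 1) := by
  set κ : ℝ → ℝ := fun ξ => if a ≤ ξ ∧ ξ ≤ b then min (π ξ) (max (π a) (π b)) else π ξ with hκd
  have hab := hax.trans hxb
  have hκ : ∀ ξ ∈ Icc a b, κ ξ = min (π ξ) (max (π a) (π b)) := fun ξ hξ => if_pos hξ
  have hκ' : ∀ ξ ∈ Icc (0 : ℝ) 1, ξ ≤ a ∨ b ≤ ξ → κ ξ = π ξ := by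
    intro ξ hξ h
    by_cases hin : ξ ∈ Icc a b
    · rw [hκ ξ hin, min_eq_left]
      rcases h with h | h
      · rw [le_antisymm h hin.1]; exact le_max_left _ _
      · rw [le_antisymm hin.2 h]; exact le_max_right _ _
    · exact if_neg hin
  refine FreeReach.of_straighten (κ := κ) ha hab hb ?_ ?_ hmid
    (fun ξ hξ h => (hκ' ξ hξ h).trans (hout ξ hξ h).symm)
    (FreeReach.of_cut_max' hδ hη hτ hπ hf hfm hf0 hf1 hmatch ha hax.le hxb.le hb hmono hanti hlt
      hκ hκ' hup)
  · have hπ' := hπ.mono (Icc_subset_Icc ha hb)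
    exact ContinuousOn.congr (f := fun ξ => min (π ξ) (max (π a) (π b))) (by fun_prop) hκ
  · have hxx₁ : x ∈ Icc a x := ⟨hax.le, le_rfl⟩
    have hxx₂ : x ∈ Icc x b := ⟨le_rfl, hxb.le⟩
    have ham : a ∈ Icc a x := ⟨le_rfl, hax.le⟩
    have hbm : b ∈ Icc x b := ⟨hxb.le, le_rfl⟩
    rcases le_total (π a) (π b) with hle | hle
    · left
      rw [max_eq_right hle] at hκ
      rw [← Icc_union_Icc_eq_Icc hax.le hxb.le]
      refine MonotoneOn.union_right (c := x) ?_ ?_ ⟨hxx₁, fun y hy => hy.2⟩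
        ⟨hxx₂, fun y hy => hy.1⟩
      · intro y hy z hz hyz
        rw [hκ y ⟨hy.1, hy.2.trans hxb.le⟩, hκ z ⟨hz.1, hz.2.trans hxb.le⟩]
        exact min_le_min (hmono hy hz hyz) le_rfl
      · intro y hy z hz hyz
        rw [hκ y ⟨hax.le.trans hy.1, hy.2⟩, hκ z ⟨hax.le.trans hz.1, hz.2⟩,
          min_eq_right (hanti hy hbm hy.2), min_eq_right (hanti hz hbm hz.2)]
    · right
      rw [max_eq_left hle] at hκ
      rw [← Icc_union_Icc_eq_Icc hax.le hxb.le]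
      refine AntitoneOn.union_right (c := x) ?_ ?_ ⟨hxx₁, fun y hy => hy.2⟩
        ⟨hxx₂, fun y hy => hy.1⟩
      · intro y hy z hz hyz
        rw [hκ y ⟨hy.1, hy.2.trans hxb.le⟩, hκ z ⟨hz.1, hz.2.trans hxb.le⟩,
          min_eq_right (hmono ham hy hy.1), min_eq_right (hmono ham hz hz.1)]
      · intro y hy z hz hyz
        rw [hκ y ⟨hax.le.trans hy.1, hy.2⟩, hκ z ⟨hax.le.trans hz.1, hz.2⟩]
        exact min_le_min (hanti hy hz hyz) le_rfl

/-- Removing a turning point of the second curve preserves the matching if the first curve rises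
or falls steadily there. -/
lemma FreeReach.of_shortcut {τ π π' f : ℝ → ℝ} {δ η a x b : ℝ} (hδ : 0 < δ) (hη : 0 < η)
    (hτ : ContinuousOn τ (Icc 0 1)) (hπ : ContinuousOn π (Icc 0 1))
    (hf : ContinuousOn f (Icc 0 1)) (hfm : MonotoneOn f (Icc 0 1)) (hf0 : f 0 = 0) (hf1 : f 1 = 1)
    (hmatch : ∀ ξ ∈ Icc (0 : ℝ) 1, |τ (f ξ) - π ξ| ≤ δ)
    (ha : 0 ≤ a) (hax : a < x) (hxb : x < b) (hb : b ≤ 1)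
    (h₁ : (π a ≤ π x → MonotoneOn π (Icc a x)) ∧ (π x ≤ π a → AntitoneOn π (Icc a x)))
    (h₂ : (π x ≤ π b → MonotoneOn π (Icc x b)) ∧ (π b ≤ π x → AntitoneOn π (Icc x b)))
    (hmid : ∀ ξ ∈ Icc a b, π' ξ = π a + (ξ - a) / (b - a) * (π b - π a))
    (hout : ∀ ξ ∈ Icc (0 : ℝ) 1, ξ ≤ a ∨ b ≤ ξ → π' ξ = π ξ)
    (hup : UpAt δ τ (π x) (f x) ∨ UpAt δ (fun y => -τ y) (-π x) (f x)) :
    FreeReach τ π' (δ + η) (0, 0) (1, 1) := by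
  by_cases hmax : max (π a) (π b) < π x
  · exact FreeReach.of_shortcut_max hδ hη hτ hπ hf hfm hf0 hf1 hmatch ha hax hxb hb
      (h₁.1 ((le_max_left _ _).trans hmax.le)) (h₂.2 ((le_max_right _ _).trans hmax.le)) hmax
      hmid hout hup
  by_cases hmin : π x < min (π a) (π b)
  · have := (FreeReach.of_shortcut_max (τ := fun y => -τ y) (π := fun ξ => -π ξ)
      (π' := fun ξ => -π' ξ) hδ hη hτ.neg hπ.neg hf hfm hf0 hf1
      (fun ξ hξ => by rw [← neg_sub', abs_neg]; exact hmatch ξ hξ) ha hax hxb hb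
      (h₁.2 (hmin.le.trans (min_le_left _ _))).neg (h₂.1 (hmin.le.trans (min_le_right _ _))).neg
      (by rw [max_neg_neg]; exact neg_lt_neg hmin)
      (fun ξ hξ => by rw [hmid ξ hξ]; ring)
      (fun ξ hξ h => by rw [hout ξ hξ h]) (by simpa using hup.symm)).neg
    simpa using this
  refine FreeReach.of_straighten (κ := π) ha (hax.trans hxb) hb (hπ.mono (Icc_subset_Icc ha hb)) ?_
    hmid (fun ξ hξ h => (hout ξ hξ h).symm) ?_
  · rw [← Icc_union_Icc_eq_Icc hax.le hxb.le]
    have hl : IsGreatest (Icc a x) x := ⟨⟨hax.le, le_rfl⟩, fun y hy => hy.2⟩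
    have hr : IsLeast (Icc x b) x := ⟨⟨le_rfl, hxb.le⟩, fun y hy => hy.1⟩
    rw [lt_min_iff, not_and_or, not_lt, not_lt] at hmin
    rw [max_lt_iff, not_and_or, not_lt, not_lt] at hmax
    rcases le_total (π a) (π x) with h | h <;> rcases le_total (π x) (π b) with h' | h'
    · exact Or.inl ((h₁.1 h).union_right (h₂.1 h') hl hr)
    · rcases hmax with h3 | h3
      · exact Or.inr ((h₁.2 h3).union_right (h₂.2 h') hl hr)
      · exact Or.inl ((h₁.1 h).union_right (h₂.1 h3) hl hr)
    · rcases hmin with h3 | h3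
      · exact Or.inl ((h₁.1 h3).union_right (h₂.1 h') hl hr)
      · exact Or.inr ((h₁.2 h).union_right (h₂.2 h3) hl hr)
    · exact Or.inr ((h₁.2 h).union_right (h₂.2 h') hl hr)
  · have := FreeReach.of_matching (τ := τ) (π := π) hη zero_le_one hf hfm hπ hmatch
    rwa [hf0, hf1] at this

lemma exists_mem_segment {s : ℕ → ℝ} {y : ℝ} : ∀ {N : ℕ}, s 0 ≤ y → y ≤ s (N + 1) →
    ∃ j, j < N + 1 ∧ y ∈ Icc (s j) (s (j + 1))
  | 0, h0, h1 => ⟨0, by omega, h0, h1⟩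
  | N + 1, h0, h1 => by
    rcases le_total (s (N + 1)) y with h | h
    · exact ⟨N + 1, by omega, h, h1⟩
    · obtain ⟨j, hj, hy⟩ := exists_mem_segment h0 h
      exact ⟨j, by omega, hy⟩

lemma monotone_of_lt_succ {s : ℕ → ℝ} {N : ℕ} (hs : ∀ i, i + 1 < N → s i < s (i + 1)) {i j : ℕ}
    (hij : i ≤ j) (hj : j < N) : s i ≤ s j := by
  induction j, hij using Nat.le_induction with
  | base => exact le_rfl
  | succ j hij ih => exact (ih (by omega)).trans (hs j hj).le

namespace IsPolyOn

variable {c : ℝ → ℝ} {m : ℕ} {t w : ℕ → ℝ}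

lemma apply_left (h : IsPolyOn c m t w) {i : ℕ} (hi : i + 1 < m) : c (t i) = w i := by
  rw [h.2.2.2.2 i hi (t i) ⟨le_rfl, (h.2.2.2.1 i hi).le⟩]; simp

lemma apply_right (h : IsPolyOn c m t w) {i : ℕ} (hi : i + 1 < m) :
    c (t (i + 1)) = w (i + 1) := by
  have hlt := h.2.2.2.1 i hi
  rw [h.2.2.2.2 i hi (t (i + 1)) ⟨hlt.le, le_rfl⟩, div_self (sub_pos.2 hlt).ne']; ring

lemma apply_vertex (h : IsPolyOn c m t w) {i : ℕ} (hi : i < m) : c (t i) = w i := by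
  rcases i with _ | i
  · exact h.apply_left (by have := h.1; omega)
  · exact h.apply_right hi

lemma mem_Icc (h : IsPolyOn c m t w) {i : ℕ} (hi : i < m) : t i ∈ Icc (0 : ℝ) 1 := by
  have h2 := h.1
  constructor
  · rw [← h.2.1]; exact monotone_of_lt_succ h.2.2.2.1 (Nat.zero_le i) hi
  · rw [← h.2.2.1]; exact monotone_of_lt_succ h.2.2.2.1 (by omega) (by omega)

lemma edge (h : IsPolyOn c m t w) {i : ℕ} (hi : i + 1 < m) :
    (w i ≤ w (i + 1) → MonotoneOn c (Icc (t i) (t (i + 1)))) ∧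
      (w (i + 1) ≤ w i → AntitoneOn c (Icc (t i) (t (i + 1)))) := by
  have hlt := sub_pos.2 (h.2.2.2.1 i hi)
  constructor <;> intro hw y hy z hz hyz <;>
    rw [h.2.2.2.2 i hi y hy, h.2.2.2.2 i hi z hz] <;> gcongr 1
  · exact mul_le_mul_of_nonneg_right (by gcongr) (by linarith)
  · exact mul_le_mul_of_nonpos_right (by gcongr) (by linarith)

lemma continuousOn (h : IsPolyOn c m t w) : ContinuousOn c (Icc 0 1) := by
  have key : ∀ j, j < m → ContinuousOn c (Icc (t 0) (t j)) := by
    intro j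
    induction j with
    | zero => intro _; simp
    | succ j ih =>
      intro hj
      rw [← Icc_union_Icc_eq_Icc
        (monotone_of_lt_succ h.2.2.2.1 (Nat.zero_le j) (by omega)) (h.2.2.2.1 j hj).le]
      refine (ih (by omega)).union_of_isClosed ?_ isClosed_Icc isClosed_Icc
      exact ContinuousOn.congr (by fun_prop) (h.2.2.2.2 j hj)
  have := key (m - 1) (by have := h.1; omega)
  rwa [h.2.1, h.2.2.1] at this

lemma exists_edge (h : IsPolyOn c m t w) {x : ℝ} (hx : x ∈ Icc (0 : ℝ) 1) :
    ∃ q, q + 1 < m ∧ x ∈ Icc (t q) (t (q + 1)) := by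
  have h2 := h.1
  obtain ⟨q, hq, hxq⟩ := exists_mem_segment (s := t) (y := x) (N := m - 2) (by rw [h.2.1]; exact hx.1)
    (by rw [show m - 2 + 1 = m - 1 by omega, h.2.2.1]; exact hx.2)
  exact ⟨q, by omega, hxq⟩

/-- The polygonal curve with one interior vertex removed. -/
lemma erase (h : IsPolyOn c m t w) {i : ℕ} (hi : 1 ≤ i) (him : i + 1 < m) {c' : ℝ → ℝ}
    (hmid : ∀ ξ ∈ Icc (t (i - 1)) (t (i + 1)), c' ξ = c (t (i - 1)) +
      (ξ - t (i - 1)) / (t (i + 1) - t (i - 1)) * (c (t (i + 1)) - c (t (i - 1))))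
    (hout : ∀ ξ ∈ Icc (0 : ℝ) 1, ξ ≤ t (i - 1) ∨ t (i + 1) ≤ ξ → c' ξ = c ξ) :
    IsPolyOn c' (m - 1) (fun j => if j < i then t j else t (j + 1))
      (fun j => if j < i then w j else w (j + 1)) := by
  refine ⟨by omega, ?_, ?_, fun j hj => ?_, fun j hj u hu => ?_⟩
  · simp only [show 0 < i by omega, if_true, h.2.1]
  · simp only [show ¬ m - 1 - 1 < i by omega, if_false]
    rw [show m - 1 - 1 + 1 = m - 1 by omega, h.2.2.1]
  · rcases lt_trichotomy (j + 1) i with h1 | h1 | h1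
    · simp only [show j < i by omega, h1, if_true]; exact h.2.2.2.1 j (by omega)
    · simp only [show j < i by omega, h1, lt_irrefl, if_true, if_false]
      exact (h.2.2.2.1 j (by omega)).trans (h1 ▸ h.2.2.2.1 (j + 1) (by omega))
    · simp only [show ¬ j < i by omega, show ¬ j + 1 < i by omega, if_false]
      exact h.2.2.2.1 (j + 1) (by omega)
  · rcases lt_trichotomy (j + 1) i with h1 | h1 | h1
    · simp only [show j < i by omega, h1, if_true] at hu ⊢
      rw [hout u, h.2.2.2.2 j (by omega) u hu]
      · exact ⟨(h.mem_Icc (by omega)).1.trans hu.1, hu.2.trans (h.mem_Icc (by omega)).2⟩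
      · exact Or.inl (hu.2.trans (monotone_of_lt_succ h.2.2.2.1 (by omega) (by omega)))
    · subst h1
      simp only [lt_add_iff_pos_right, zero_lt_one, lt_irrefl, if_true, if_false] at hu ⊢
      rw [hmid u hu, add_tsub_cancel_right, h.apply_vertex (i := j) (by omega),
        h.apply_vertex (i := j + 1 + 1) (by omega)]
    · simp only [show ¬ j < i by omega, show ¬ j + 1 < i by omega, if_false] at hu ⊢
      rw [hout u, h.2.2.2.2 (j + 1) (by omega) u hu]
      · exact ⟨(h.mem_Icc (by omega)).1.trans hu.1, hu.2.trans (h.mem_Icc (by omega)).2⟩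
      · exact Or.inr ((monotone_of_lt_succ h.2.2.2.1 (by omega) (by omega)).trans hu.1)

end IsPolyOn

namespace IsSignature

variable {α : ℝ} {τ : ℝ → ℝ} {L : ℕ} {s : ℕ → ℝ}

lemma neg (h : IsSignature α τ L s) : IsSignature α (fun a => -τ a) L s := by
  have hu : ∀ x a b : ℝ, -x ∈ uIcc (-a) (-b) ↔ x ∈ uIcc a b := fun x a b => by
    simp only [mem_uIcc, neg_le_neg_iff]; tauto
  have hI : ∀ x a : ℝ, -x ∈ Icc (-a - α) (-a + α) ↔ x ∈ Icc (a - α) (a + α) := fun x a => by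
    simp only [mem_Icc]
    constructor <;> rintro ⟨h1, h2⟩ <;> constructor <;> linarith
  have hd : ∀ a b : ℝ, |(-a) - (-b)| = |a - b| := fun a b => by
    rw [← neg_sub', abs_neg]
  simp only [IsSignature, mem_union, hu, hI, hd]
  obtain ⟨h1, h2, h3, h4, h5, h6, h7⟩ := h
  refine ⟨h1, h2, h3, h4, h5, fun i hi a b ha hab hb => ⟨fun hlt => ?_, fun hlt => ?_⟩, h7⟩
  · have := (h6 i hi a b ha hab hb).2 (by linarith); linarith
  · have := (h6 i hi a b ha hab hb).1 (by linarith); linarith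

lemma lt_abs_edge (h : IsSignature α τ L s) (hα : 0 < α) {j : ℕ} (hj : j + 1 < L) :
    α < |τ (s (j + 1)) - τ (s j)| := by
  obtain ⟨-, -, -, -, -, -, h7, h8, h9, -⟩ := h
  rcases Nat.eq_zero_or_pos j with rfl | hj0
  · exact h8
  rcases Nat.lt_or_ge (j + 2) L with hlt | hge
  · linarith [h7 j hj0 (by omega)]
  · rwa [show L - 1 = j + 1 by omega, show L - 2 = j by omega] at h9

lemma ne_succ (h : IsSignature α τ L s) (hα : 0 < α) {j : ℕ} (hj : j + 1 < L) :
    τ (s j) ≠ τ (s (j + 1)) := by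
  intro heq
  have := h.lt_abs_edge hα hj
  rw [heq, sub_self, abs_zero] at this
  linarith

lemma back (h : IsSignature α τ L s) (hα : 0 < α) {j : ℕ} (hj : j + 1 < L)
    (hlt : τ (s j) < τ (s (j + 1))) {a b : ℝ} (ha : s j ≤ a) (hab : a ≤ b)
    (hb : b ≤ s (j + 1)) : τ a - τ b ≤ 2 * α := by
  rcases hab.eq_or_lt with rfl | hab
  · linarith
  · exact (h.2.2.2.2.2.1 j hj a b ha hab hb).1 hlt

/-- On a rising signature edge the curve exceeds the upper vertex by at most `α`, and not at all
if the upper vertex is interior. -/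
lemma le_top (h : IsSignature α τ L s) (hα : 0 < α) {j : ℕ} (hj : j + 1 < L)
    (hlt : τ (s j) < τ (s (j + 1))) {a : ℝ} (ha : a ∈ Icc (s j) (s (j + 1))) :
    τ a ≤ τ (s (j + 1)) + α ∧ (j + 2 < L → τ a ≤ τ (s (j + 1))) := by
  have hlen := h.lt_abs_edge hα hj
  rw [abs_of_pos (sub_pos.2 hlt)] at hlen
  obtain ⟨h1, -, -, -, -, -, -, -, -, h10, h11, h12, h13⟩ := h
  rcases Nat.eq_zero_or_pos j with rfl | hj0
  · rcases h1.eq_or_lt with h2 | h2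
    · rcases h13 h2.symm a ha with (hu | hu) | hu
      · rw [uIcc_of_le hlt.le] at hu
        exact ⟨by linarith [hu.2], fun h => by omega⟩
      · exact ⟨by linarith [hu.2], fun h => by omega⟩
      · exact ⟨hu.2, fun h => by omega⟩
    · rcases h11 h2 a ha with hu | hu
      · rw [uIcc_of_le hlt.le] at hu
        exact ⟨by linarith [hu.2], fun _ => hu.2⟩
      · exact ⟨by linarith [hu.2], fun _ => by linarith [hu.2]⟩
  rcases Nat.lt_or_ge (j + 2) L with hlt' | hge
  · have hu := h10 j hj0 (by omega) a ha
    rw [uIcc_of_le hlt.le] at hu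
    exact ⟨by linarith [hu.2], fun _ => hu.2⟩
  · rw [show L - 1 = j + 1 by omega, show L - 2 = j by omega] at h12
    rcases h12 (by omega) a ha with hu | hu
    · rw [uIcc_of_le hlt.le] at hu
      exact ⟨by linarith [hu.2], fun h => by omega⟩
    · exact ⟨hu.2, fun h => by omega⟩

/-- On a falling signature edge the curve exceeds the upper vertex by at most `α`, and not at all
if the upper vertex is interior. -/
lemma le_top' (h : IsSignature α τ L s) (hα : 0 < α) {j : ℕ} (hj : j + 1 < L)
    (hlt : τ (s (j + 1)) < τ (s j)) {a : ℝ} (ha : a ∈ Icc (s j) (s (j + 1))) :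
    τ a ≤ τ (s j) + α ∧ (1 ≤ j → τ a ≤ τ (s j)) := by
  have hlen := h.lt_abs_edge hα hj
  rw [abs_of_neg (sub_neg.2 hlt)] at hlen
  obtain ⟨h1, -, -, -, -, -, -, -, -, h10, h11, h12, h13⟩ := h
  rcases Nat.eq_zero_or_pos j with rfl | hj0
  · rcases h1.eq_or_lt with h2 | h2
    · rcases h13 h2.symm a ha with (hu | hu) | hu
      · rw [uIcc_of_ge hlt.le] at hu
        exact ⟨by linarith [hu.2], fun h => by omega⟩
      · exact ⟨by linarith [hu.2], fun h => by omega⟩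
      · exact ⟨by linarith [hu.2], fun h => by omega⟩
    · rcases h11 h2 a ha with hu | hu
      · rw [uIcc_of_ge hlt.le] at hu
        exact ⟨by linarith [hu.2], fun h => by omega⟩
      · exact ⟨by linarith [hu.2], fun h => by omega⟩
  rcases Nat.lt_or_ge (j + 2) L with hlt' | hge
  · have hu := h10 j hj0 (by omega) a ha
    rw [uIcc_of_ge hlt.le] at hu
    exact ⟨by linarith [hu.2], fun _ => hu.2⟩
  · rw [show L - 1 = j + 1 by omega, show L - 2 = j by omega] at h12
    rcases h12 (by omega) a ha with hu | hu
    · rw [uIcc_of_ge hlt.le] at hu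
      exact ⟨by linarith [hu.2], fun _ => hu.2⟩
    · exact ⟨by linarith [hu.2], fun _ => by linarith [hu.2]⟩

lemma ge_bot (h : IsSignature α τ L s) (hα : 0 < α) {j : ℕ} (hj : j + 1 < L)
    (hlt : τ (s j) < τ (s (j + 1))) {a : ℝ} (ha : a ∈ Icc (s j) (s (j + 1))) :
    τ (s j) - α ≤ τ a ∧ (1 ≤ j → τ (s j) ≤ τ a) := by
  obtain ⟨h1, h2⟩ := h.neg.le_top' hα hj (neg_lt_neg hlt) ha
  exact ⟨by linarith, fun h => neg_le_neg_iff.1 (h2 h)⟩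

/-- An interior signature vertex reached by a rising edge is left by a falling one. -/
lemma falling_of_rising (h : IsSignature α τ L s) {j : ℕ} (hj : j + 2 < L)
    (hlt : τ (s j) < τ (s (j + 1))) : τ (s (j + 2)) < τ (s (j + 1)) := by
  have := h.2.2.2.2.1 (j + 1) (by omega) (by omega)
  by_contra! hle
  exact this (by rw [add_tsub_cancel_right]; exact mem_uIcc.2 (Or.inl ⟨hlt.le, hle⟩))

/-- An interior signature vertex left by a falling edge is reached by a rising one. -/
lemma rising_of_falling (h : IsSignature α τ L s) {j : ℕ} (hj : j + 2 < L)
    (hlt : τ (s (j + 2)) < τ (s (j + 1))) : τ (s j) < τ (s (j + 1)) := by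
  have := h.2.2.2.2.1 (j + 1) (by omega) (by omega)
  by_contra! hle
  exact this (by rw [add_tsub_cancel_right]; exact mem_uIcc.2 (Or.inr ⟨hlt.le, hle⟩))

/-- An interior signature vertex reached by a rising edge is a local maximum. -/
lemma le_peak (h : IsSignature α τ L s) (hα : 0 < α) {j : ℕ} (hj : j + 2 < L)
    (hlt : τ (s j) < τ (s (j + 1))) {a : ℝ} (ha : a ∈ Icc (s j) (s (j + 2))) :
    τ a ≤ τ (s (j + 1)) := by
  rcases le_total a (s (j + 1)) with h1 | h1
  · exact (h.le_top hα (by omega) hlt ⟨ha.1, h1⟩).2 hj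
  · exact (h.le_top' hα hj (h.falling_of_rising hj hlt) ⟨h1, ha.2⟩).2 (by omega)

/-- A value well separated from all signature vertices is crossed inside a signature edge. -/
lemma upAt_of_rising (h : IsSignature α τ L s) (hα : 0 < α) {ε u y : ℝ} (hε : 0 < ε)
    (hεα : 3 * ε ≤ α) (hint : ∀ j, 1 ≤ j → j + 3 ≤ L → 2 * (α + ε) < |τ (s (j + 1)) - τ (s j)|)
    (hedge : ∀ j, j + 1 < L → α + 5 * ε < |τ (s (j + 1)) - τ (s j)|)
    (hfar : ∀ j, j < L → 4 * α < |u - τ (s j)|) (hu : |τ y - u| ≤ α + ε) {j : ℕ}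
    (hj : j + 1 < L) (hy : y ∈ Icc (s j) (s (j + 1))) (hlt : τ (s j) < τ (s (j + 1))) :
    UpAt (α + ε) τ u y := by
  have hslt := h.2.2.2.1
  have hs0 : 0 ≤ s j := by
    rw [← h.2.1]; exact monotone_of_lt_succ hslt (Nat.zero_le j) (by omega)
  have hs1 : s (j + 1) ≤ 1 := by
    rw [← h.2.2.1]; exact monotone_of_lt_succ hslt (by omega) (by omega)
  have hu' := abs_le.1 hu
  have h1 := (h.le_top hα hj hlt hy).1
  have h2 := (h.ge_bot hα hj hlt hy).1
  have hlow : τ (s j) + 4 * α < u := by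
    rcases lt_abs.1 (hfar j (by omega)) with h3 | h3 <;> linarith
  have hhigh : u + 4 * α < τ (s (j + 1)) := by
    rcases lt_abs.1 (hfar (j + 1) hj) with h3 | h3 <;> linarith
  refine ⟨s j, s (j + 1), hs0, hy.1, hy.2, hs1, fun a b ha hab hb => ?_, by linarith, by linarith,
    ?_, ?_⟩
  · linarith [h.back hα hj hlt ha hab hb]
  · rcases Nat.eq_zero_or_pos j with rfl | hj0
    · exact Or.inl h.2.1
    obtain ⟨i, rfl⟩ : ∃ i, j = i + 1 := ⟨j - 1, by omega⟩
    have hn := h.neg.rising_of_falling (j := i) (by omega) (neg_lt_neg hlt)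
    have hlt' : τ (s (i + 1)) < τ (s i) := neg_lt_neg_iff.1 hn
    have hi0 : 0 ≤ s i := by
      rw [← h.2.1]; exact monotone_of_lt_succ hslt (Nat.zero_le i) (by omega)
    rcases lt_or_ge (τ (s (i + 1)) + 2 * (α + ε)) (τ (s i)) with hbig | hsmall
    · refine Or.inr (Or.inr ⟨s i, hi0, (hslt i (by omega)).le, fun a ha => ?_, hbig⟩)
      exact neg_le_neg_iff.1 (h.neg.le_peak hα (by omega) hn ha)
    · have hi : i = 0 := by
        by_contra hne
        have := hint i (by omega) (by omega)
        rw [abs_of_neg (sub_neg.2 hlt')] at this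
        linarith
      have h3 := hedge i (by omega)
      rw [abs_of_neg (sub_neg.2 hlt')] at h3
      refine Or.inr (Or.inl ?_)
      rcases lt_abs.1 (hfar i (by omega)) with h4 | h4 <;> linarith
  · rcases Nat.lt_or_ge (j + 2) L with hj2 | hj2
    · have hlt' := h.falling_of_rising hj2 hlt
      have hj1 : s (j + 2) ≤ 1 := by
        rw [← h.2.2.1]; exact monotone_of_lt_succ hslt (by omega) (by omega)
      rcases lt_or_ge (τ (s (j + 2)) + 2 * (α + ε)) (τ (s (j + 1))) with hbig | hsmall
      · exact Or.inr (Or.inr ⟨s (j + 2), (hslt (j + 1) hj2).le, hj1,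
          fun a ha => h.le_peak hα hj2 hlt ha, hbig⟩)
      · have hjL : j + 3 = L := by
          by_contra hne
          have := hint (j + 1) (by omega) (by omega)
          rw [abs_of_neg (sub_neg.2 hlt')] at this
          linarith
        have h3 := hedge (j + 1) (by omega)
        rw [abs_of_neg (sub_neg.2 hlt')] at h3
        refine Or.inr (Or.inl ?_)
        rcases lt_abs.1 (hfar (j + 2) hj2) with h4 | h4 <;> linarith
    · left
      rw [← h.2.2.1, show L - 1 = j + 1 by omega]

lemma exists_edge (h : IsSignature α τ L s) {y : ℝ} (hy : y ∈ Icc (0 : ℝ) 1) :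
    ∃ j, j + 1 < L ∧ y ∈ Icc (s j) (s (j + 1)) := by
  have h2 := h.1
  obtain ⟨j, hj, hyj⟩ := exists_mem_segment (s := s) (y := y) (N := L - 2)
    (by rw [h.2.1]; exact hy.1) (by rw [show L - 2 + 1 = L - 1 by omega, h.2.2.1]; exact hy.2)
  exact ⟨j, by omega, hyj⟩

open Filter Topology in
lemma eventually_upAt (h : IsSignature α τ L s) (hα : 0 < α) {u : ℝ}
    (hfar : ∀ j, j < L → 4 * α < |u - τ (s j)|) :
    ∀ᶠ ε in 𝓝[>] (0 : ℝ), ∀ y ∈ Icc (0 : ℝ) 1, |τ y - u| ≤ α + ε →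
      UpAt (α + ε) τ u y ∨ UpAt (α + ε) (fun a => -τ a) (-u) y := by
  have hlim : ∀ r C : ℝ, r < C → ∀ᶠ ε in 𝓝[>] (0 : ℝ), r + 5 * ε < C := by
    intro r C hC
    have : Tendsto (fun ε : ℝ => r + 5 * ε) (𝓝[>] 0) (𝓝 (r + 5 * 0)) :=
      ((continuous_const.add (continuous_const.mul continuous_id)).tendsto 0).mono_left
        nhdsWithin_le_nhds
    exact this.eventually_lt_const (by simpa using hC)
  have h1 : ∀ᶠ ε in 𝓝[>] (0 : ℝ), ∀ j ∈ Finset.range L,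
      1 ≤ j → j + 3 ≤ L → 2 * α + 5 * ε < |τ (s (j + 1)) - τ (s j)| := by
    refine (Filter.eventually_all_finset _).2 fun j _ => ?_
    by_cases hj : 1 ≤ j ∧ j + 3 ≤ L
    · exact (hlim _ _ (h.2.2.2.2.2.2.1 j hj.1 hj.2)).mono fun ε hε _ _ => hε
    · exact Eventually.of_forall fun ε h1 h2 => absurd ⟨h1, h2⟩ hj
  have h2 : ∀ᶠ ε in 𝓝[>] (0 : ℝ), ∀ j ∈ Finset.range L,
      j + 1 < L → α + 5 * ε < |τ (s (j + 1)) - τ (s j)| := by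
    refine (Filter.eventually_all_finset _).2 fun j _ => ?_
    by_cases hj : j + 1 < L
    · exact (hlim _ _ (h.lt_abs_edge hα hj)).mono fun ε hε _ => hε
    · exact Eventually.of_forall fun ε h1 => absurd h1 hj
  filter_upwards [h1, h2, Ioo_mem_nhdsGT (show (0 : ℝ) < α / 3 by positivity)]
    with ε hint hedge hε y hy hyu
  have hε0 := hε.1
  have hε3 := hε.2
  obtain ⟨j, hj, hyj⟩ := h.exists_edge hy
  have hd : ∀ a b : ℝ, |(-a) - (-b)| = |a - b| := fun a b => by rw [← neg_sub', abs_neg]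
  have hint' : ∀ j, 1 ≤ j → j + 3 ≤ L → 2 * (α + ε) < |τ (s (j + 1)) - τ (s j)| :=
    fun i h3 h4 => by linarith [hint i (Finset.mem_range.2 (by omega)) h3 h4]
  have hedge' : ∀ j, j + 1 < L → α + 5 * ε < |τ (s (j + 1)) - τ (s j)| :=
    fun i h3 => hedge i (Finset.mem_range.2 (by omega)) h3
  rcases lt_or_gt_of_ne (h.ne_succ hα hj) with hlt | hlt
  · exact Or.inl (h.upAt_of_rising hα hε0 (by linarith) hint' hedge' hfar hyu hj hyj hlt)
  · exact Or.inr (h.neg.upAt_of_rising hα hε0 (by linarith)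
      (fun i h3 h4 => by rw [hd]; exact hint' i h3 h4) (fun i h3 => by rw [hd]; exact hedge' i h3)
      (fun i h3 => by rw [hd]; exact hfar i h3) (by rwa [hd]) hj hyj (neg_lt_neg hlt))

end IsSignature

lemma abs_endpoints_le_of_frechetDist_le {τ π : ℝ → ℝ} {α : ℝ} (hτ : ContinuousOn τ (Icc 0 1))
    (hπ : ContinuousOn π (Icc 0 1)) (h : frechetDist τ π ≤ α) :
    |τ 0 - π 0| ≤ α ∧ |τ 1 - π 1| ≤ α := by
  constructor <;> refine le_of_forall_pos_le_add fun ε hε => ?_ <;>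
    obtain ⟨f, ⟨-, -, hf0, hf1⟩, hf⟩ := exists_isReparam_of_frechetDist_le hτ hπ h hε
  · simpa [hf0] using hf 0 (by simp)
  · simpa [hf1] using hf 1 (by simp)

open Filter Topology in
/-- A vertex of the center far from all signature vertices may be removed. -/
lemma frechetDist_erase_le {α : ℝ} (hα : 0 < α) {τ c c' : ℝ → ℝ} {L m i : ℕ} {s t w : ℕ → ℝ}
    (hτ : ContinuousOn τ (Icc 0 1)) (hsig : IsSignature α τ L s) (hc : IsPolyOn c m t w)
    (hi : 1 ≤ i) (him : i + 1 < m)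
    (hmid : ∀ ξ ∈ Icc (t (i - 1)) (t (i + 1)), c' ξ = c (t (i - 1)) +
      (ξ - t (i - 1)) / (t (i + 1) - t (i - 1)) * (c (t (i + 1)) - c (t (i - 1))))
    (hout : ∀ ξ ∈ Icc (0 : ℝ) 1, ξ ≤ t (i - 1) ∨ t (i + 1) ≤ ξ → c' ξ = c ξ)
    (hd : frechetDist τ c ≤ α) (hfar : ∀ j, j < L → 4 * α < |w i - τ (s j)|) :
    frechetDist τ c' ≤ α := by
  have hcc := hc.continuousOn
  have hx := hc.mem_Icc (i := i) (by omega)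
  have ha := hc.mem_Icc (i := i - 1) (by omega)
  have hb := hc.mem_Icc him
  have hwi := hc.apply_vertex (i := i) (by omega)
  refine frechetDist_le_of_freeReach hτ (hc.erase hi him hmid hout).continuousOn ?_ fun ε hε => ?_
  · rw [hout 0 (by simp) (Or.inl ha.1)]
    exact (abs_endpoints_le_of_frechetDist_le hτ hcc hd).1
  obtain ⟨ε', hup, hε'⟩ :=
    ((hsig.eventually_upAt hα hfar).and (Ioo_mem_nhdsGT hε)).exists
  obtain ⟨f, ⟨hfc, hfm, hf0, hf1⟩, hf⟩ := exists_isReparam_of_frechetDist_le hτ hcc hd hε'.1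
  have hfx : f (t i) ∈ Icc (0 : ℝ) 1 := by
    constructor
    · rw [← hf0]; exact hfm.monotoneOn ⟨le_rfl, zero_le_one⟩ hx hx.1
    · rw [← hf1]; exact hfm.monotoneOn hx ⟨zero_le_one, le_rfl⟩ hx.2
  have hpred : i - 1 + 1 = i := by omega
  have hlt := hc.2.2.2.1 (i - 1) (by omega)
  have hedge := hc.edge (i := i - 1) (by omega)
  rw [hpred] at hlt hedge
  have := FreeReach.of_shortcut (δ := α + ε') (η := ε - ε') (x := t i) (by linarith [hε'.1])
    (by linarith [hε'.2]) hτ hcc hfc hfm.monotoneOn hf0 hf1 hf ha.1 hlt (hc.2.2.2.1 i him) hb.2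
    (by rw [hc.apply_vertex (i := i - 1) (by omega), hwi]; exact hedge)
    (by rw [hc.apply_vertex him, hwi]; exact hc.edge him) hmid hout
    (by rw [hwi]; exact hup _ hfx (hwi ▸ hf _ hx))
  rwa [show α + ε' + (ε - ε') = α + ε by ring] at this

/-- A center with as few vertices as possible only has vertices near signature vertices. -/
lemma exists_center_near_signatures {α : ℝ} (hα : 0 < α) {S : Set ℕ} (hS : S.Nonempty)
    {τ : ℕ → ℝ → ℝ} {L : ℕ → ℕ} {s : ℕ → ℕ → ℝ} {U : Set ℝ}
    (hτ : ∀ i ∈ S, ContinuousOn (τ i) (Icc 0 1)) (hsig : ∀ i ∈ S, IsSignature α (τ i) (L i) (s i))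
    (hU : ∀ y, y ∉ U → ∀ i ∈ S, ∀ j, j < L i → 4 * α < |y - τ i (s i j)|) {m : ℕ} :
    ∀ {c : ℝ → ℝ} {t w : ℕ → ℝ}, IsPolyOn c m t w → (∀ i ∈ S, frechetDist (τ i) c ≤ α) →
    ∃ (c' : ℝ → ℝ) (m' : ℕ) (t' w' : ℕ → ℝ), m' ≤ m ∧ IsPolyOn c' m' t' w' ∧
      (∀ i ∈ S, frechetDist (τ i) c' ≤ α) ∧ ∀ v, v < m' → w' v ∈ U := by
  induction m with
  | zero => intro c t w hc; exact absurd hc.1 (by omega)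
  | succ m ih =>
    intro c t w hc hd
    by_cases hall : ∀ v, v < m + 1 → w v ∈ U
    · exact ⟨c, m + 1, t, w, le_rfl, hc, hd, hall⟩
    push Not at hall
    obtain ⟨v, hv, hvU⟩ := hall
    have hm2 := hc.1
    obtain ⟨i, hi⟩ := hS
    have hend := abs_endpoints_le_of_frechetDist_le (hτ i hi) hc.continuousOn (hd i hi)
    have hL := (hsig i hi).1
    have hv1 : 1 ≤ v := by
      by_contra h0
      have hfar := hU _ hvU i hi 0 (by omega)
      obtain rfl : v = 0 := by omega
      rw [(hsig i hi).2.1, abs_sub_comm, ← hc.apply_vertex hv, hc.2.1] at hfar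
      linarith [hend.1]
    have hvm : v + 1 < m + 1 := by
      by_contra h0
      have hfar := hU _ hvU i hi (L i - 1) (by omega)
      obtain rfl : v = m := by omega
      have hvt : t v = 1 := hc.2.2.1
      rw [(hsig i hi).2.2.1, abs_sub_comm, ← hc.apply_vertex hv, hvt] at hfar
      linarith [hend.2]
    set c' : ℝ → ℝ := fun ξ => if t (v - 1) < ξ ∧ ξ < t (v + 1) then c (t (v - 1)) +
      (ξ - t (v - 1)) / (t (v + 1) - t (v - 1)) * (c (t (v + 1)) - c (t (v - 1))) else c ξ with hc'
    have hlt : t (v - 1) < t (v + 1) :=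
      (hc.2.2.2.1 (v - 1) (by omega)).trans_le
        (monotone_of_lt_succ hc.2.2.2.1 (by omega) (by omega))
    have hmid : ∀ ξ ∈ Icc (t (v - 1)) (t (v + 1)), c' ξ = c (t (v - 1)) +
        (ξ - t (v - 1)) / (t (v + 1) - t (v - 1)) * (c (t (v + 1)) - c (t (v - 1))) := by
      intro ξ hξ
      simp only [hc']
      split_ifs with hin
      · rfl
      · rcases hξ.1.eq_or_lt with rfl | h1
        · simp
        · have h2 : ξ = t (v + 1) := by
            by_contra hne
            exact hin ⟨h1, lt_of_le_of_ne hξ.2 hne⟩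
          rw [h2, div_self (sub_pos.2 hlt).ne']; ring
    have hout : ∀ ξ ∈ Icc (0 : ℝ) 1, ξ ≤ t (v - 1) ∨ t (v + 1) ≤ ξ → c' ξ = c ξ := by
      intro ξ _ h
      exact if_neg fun hin => by rcases h with h | h <;> linarith [hin.1, hin.2]
    obtain ⟨c'', m', t', w', hm', h⟩ := ih (hc.erase hv1 hvm hmid hout) fun i hi =>
      frechetDist_erase_le hα (hτ i hi) (hsig i hi) hc hv1 hvm hmid hout (hd i hi) (hU _ hvU i hi)
    exact ⟨c'', m', t', w', by omega, h⟩

/-- Every peak of the signature is close to a vertex of the center. -/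
lemma exists_vertex_near_peak {α : ℝ} (hα : 0 < α) {τ c : ℝ → ℝ} {L m i : ℕ} {s t w : ℕ → ℝ}
    (hτ : ContinuousOn τ (Icc 0 1)) (hsig : IsSignature α τ L s) (hc : IsPolyOn c m t w)
    (hd : frechetDist τ c ≤ α) (hi : i + 2 < L) (hlt : τ (s i) < τ (s (i + 1))) :
    ∃ q, q < m ∧ |τ (s (i + 1)) - w q| ≤ 8 * α := by
  by_contra! hfar
  have hslt := hsig.2.2.2.1
  have hlt' := hsig.falling_of_rising hi hlt
  have hmem : ∀ j, j < L → s j ∈ Icc (0 : ℝ) 1 := fun j hj => by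
    constructor
    · rw [← hsig.2.1]; exact monotone_of_lt_succ hslt (Nat.zero_le j) hj
    · rw [← hsig.2.2.1]; exact monotone_of_lt_succ hslt (by omega) (by omega)
  obtain ⟨d₁, hd₁, hd₁'⟩ : ∃ d > 0, 1 ≤ i → 2 * (α + d) < τ (s (i + 1)) - τ (s i) := by
    by_cases h1 : 1 ≤ i
    · have := hsig.2.2.2.2.2.2.1 i h1 (by omega)
      rw [abs_of_pos (sub_pos.2 hlt)] at this
      exact ⟨(τ (s (i + 1)) - τ (s i) - 2 * α) / 4, by linarith, fun _ => by linarith⟩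
    · exact ⟨1, one_pos, fun h => absurd h h1⟩
  obtain ⟨d₂, hd₂, hd₂'⟩ : ∃ d > 0, i + 3 < L → 2 * (α + d) < τ (s (i + 1)) - τ (s (i + 2)) := by
    by_cases h1 : i + 3 < L
    · have := hsig.2.2.2.2.2.2.1 (i + 1) (by omega) (by omega)
      rw [abs_of_neg (sub_neg.2 hlt')] at this
      exact ⟨(τ (s (i + 1)) - τ (s (i + 2)) - 2 * α) / 4, by linarith, fun _ => by linarith⟩
    · exact ⟨1, one_pos, fun h => absurd h h1⟩
  obtain ⟨ε, hε, hε₁, hε₂, hεα⟩ : ∃ ε > 0, ε ≤ d₁ ∧ ε ≤ d₂ ∧ ε ≤ α :=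
    ⟨min (min d₁ d₂) α, lt_min (lt_min hd₁ hd₂) hα, (min_le_left _ _).trans (min_le_left _ _),
      (min_le_left _ _).trans (min_le_right _ _), min_le_right _ _⟩
  have hcc := hc.continuousOn
  obtain ⟨f, ⟨hfc, hfm, hf0, hf1⟩, hf⟩ := exists_isReparam_of_frechetDist_le hτ hcc hd hε
  have hm : ∀ ξ ∈ Icc (0 : ℝ) 1, c ξ - (α + ε) ≤ τ (f ξ) ∧ τ (f ξ) ≤ c ξ + (α + ε) :=
    fun ξ hξ => by
      have := abs_le.1 (hf ξ hξ)
      constructor <;> linarith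
  have hfI : ∀ ξ ∈ Icc (0 : ℝ) 1, f ξ ∈ Icc (0 : ℝ) 1 := fun ξ hξ => by
    constructor
    · rw [← hf0]; exact hfm.monotoneOn ⟨le_rfl, zero_le_one⟩ hξ hξ.1
    · rw [← hf1]; exact hfm.monotoneOn hξ ⟨zero_le_one, le_rfl⟩ hξ.2
  obtain ⟨x, hx, hfx⟩ := intermediate_value_Icc zero_le_one hfc
    (show s (i + 1) ∈ Icc (f 0) (f 1) by rw [hf0, hf1]; exact hmem _ (by omega))
  obtain ⟨q, hq, hxq⟩ := hc.exists_edge hx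
  have hq₀ := hc.mem_Icc (i := q) (by omega)
  have hq₁ := hc.mem_Icc hq
  have hw₀ := hc.apply_vertex (i := q) (by omega)
  have hw₁ := hc.apply_vertex hq
  have hx' := hm x hx
  rw [hfx] at hx'
  rcases le_total (w q) (w (q + 1)) with hup | hdown
  · have hmono := (hc.edge hq).1 hup
    have h1 := hmono ⟨le_rfl, hxq.1.trans hxq.2⟩ hxq hxq.1
    have h2 := hmono hxq ⟨hxq.1.trans hxq.2, le_rfl⟩ hxq.2
    rw [hw₀] at h1
    rw [hw₁] at h2
    have h3 : τ (s (i + 1)) + 8 * α < w (q + 1) := by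
      rcases lt_abs.1 (hfar (q + 1) hq) with h | h <;> linarith
    have h4 := (hm _ hq₁).1
    rw [hw₁] at h4
    have h5 : s (i + 1) ≤ f (t (q + 1)) := hfx ▸ hfm.monotoneOn hx hq₁ hxq.2
    have h6 : s (i + 2) < f (t (q + 1)) := by
      by_contra! h
      linarith [hsig.le_peak hα hi hlt ⟨(hslt i (by omega)).le.trans h5, h⟩]
    have h7 : i + 3 < L := by
      by_contra h
      have h8 := hsig.2.2.1
      rw [show L - 1 = i + 2 by omega] at h8
      linarith [(hfI _ hq₁).2]
    obtain ⟨x', h8, h9⟩ := intermediate_value_Icc hxq.2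
      (hfc.mono (Icc_subset_Icc hx.1 hq₁.2))
      (show s (i + 2) ∈ Icc (f x) (f (t (q + 1))) from
        ⟨hfx ▸ (hslt (i + 1) hi).le, h6.le⟩)
    have h10 := (hm x' ⟨hx.1.trans h8.1, h8.2.trans hq₁.2⟩).1
    rw [h9] at h10
    linarith [hmono hxq ⟨hxq.1.trans h8.1, h8.2⟩ h8.1, hd₂' h7]
  · have hanti := (hc.edge hq).2 hdown
    have h1 := hanti ⟨le_rfl, hxq.1.trans hxq.2⟩ hxq hxq.1
    have h2 := hanti hxq ⟨hxq.1.trans hxq.2, le_rfl⟩ hxq.2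
    rw [hw₀] at h1
    rw [hw₁] at h2
    have h3 : τ (s (i + 1)) + 8 * α < w q := by
      rcases lt_abs.1 (hfar q (by omega)) with h | h <;> linarith
    have h4 := (hm _ hq₀).1
    rw [hw₀] at h4
    have h5 : f (t q) ≤ s (i + 1) := hfx ▸ hfm.monotoneOn hq₀ hx hxq.1
    have h6 : f (t q) < s i := by
      by_contra! h
      linarith [hsig.le_peak hα hi hlt ⟨h, h5.trans (hslt (i + 1) hi).le⟩]
    have h7 : 1 ≤ i := by
      by_contra h
      obtain rfl : i = 0 := by omega
      linarith [hsig.2.1, (hfI _ hq₀).1]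
    obtain ⟨x', h8, h9⟩ := intermediate_value_Icc hxq.1
      (hfc.mono (Icc_subset_Icc hq₀.1 hx.2))
      (show s i ∈ Icc (f (t q)) (f x) from ⟨h6.le, hfx ▸ (hslt i (by omega)).le⟩)
    have h10 := (hm x' ⟨hq₀.1.trans h8.1, h8.2.trans hx.2⟩).1
    rw [h9] at h10
    linarith [hanti ⟨h8.1, h8.2.trans hxq.2⟩ hxq h8.2, hd₁' h7]

lemma IsPolyOn.neg {c : ℝ → ℝ} {m : ℕ} {t w : ℕ → ℝ} (h : IsPolyOn c m t w) :
    IsPolyOn (fun x => -c x) m t (fun i => -w i) :=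
  ⟨h.1, h.2.1, h.2.2.1, h.2.2.2.1, fun i hi u hu => by simp only [h.2.2.2.2 i hi u hu]; ring⟩

lemma frechetDist_neg (τ π : ℝ → ℝ) :
    frechetDist (fun x => -τ x) (fun x => -π x) = frechetDist τ π := by
  simp only [frechetDist, ← neg_sub', abs_neg]

/-- Every signature vertex is close to a vertex of the center. -/
lemma exists_vertex_near_signature {α : ℝ} (hα : 0 < α) {τ c : ℝ → ℝ} {L m j : ℕ}
    {s t w : ℕ → ℝ} (hτ : ContinuousOn τ (Icc 0 1)) (hsig : IsSignature α τ L s)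
    (hc : IsPolyOn c m t w) (hd : frechetDist τ c ≤ α) (hj : j < L) :
    ∃ q, q < m ∧ |τ (s j) - w q| ≤ 8 * α := by
  have hend := abs_endpoints_le_of_frechetDist_le hτ hc.continuousOn hd
  have hm := hc.1
  rcases Nat.eq_zero_or_pos j with rfl | hj0
  · refine ⟨0, by omega, ?_⟩
    rw [hsig.2.1, ← hc.apply_vertex (i := 0) (by omega), hc.2.1]
    linarith [hend.1]
  rcases Nat.lt_or_ge (j + 1) L with hj1 | hj1
  · obtain ⟨i, rfl⟩ : ∃ i, j = i + 1 := ⟨j - 1, by omega⟩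
    rcases lt_or_gt_of_ne (hsig.ne_succ hα hj) with hlt | hlt
    · exact exists_vertex_near_peak hα hτ hsig hc hd hj1 hlt
    · obtain ⟨q, hq, hqd⟩ := exists_vertex_near_peak (τ := fun x => -τ x) hα hτ.neg hsig.neg hc.neg
        (by rwa [frechetDist_neg]) hj1 (neg_lt_neg hlt)
      refine ⟨q, hq, ?_⟩
      rwa [neg_sub_neg, abs_sub_comm] at hqd
  · refine ⟨m - 1, by omega, ?_⟩
    rw [show j = L - 1 by omega, hsig.2.2.1, ← hc.apply_vertex (i := m - 1) (by omega), hc.2.2.1]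
    linarith [hend.2]

lemma costC_le_iff {n k : ℕ} (hn : 0 < n) (hk : 0 < k) {τ C : ℕ → ℝ → ℝ} {α : ℝ} :
    costC n k τ C ≤ α ↔ ∀ i, i < n → ∃ j, j < k ∧ frechetDist (τ i) (C j) ≤ α := by
  have hne : Nonempty (Fin n) := ⟨⟨0, hn⟩⟩
  have hke : Nonempty (Fin k) := ⟨⟨0, hk⟩⟩
  rw [costC, ciSup_le_iff (Set.finite_range _).bddAbove]
  constructor
  · intro h i hi
    obtain ⟨j, hj⟩ := exists_eq_ciInf_of_finite (f := fun j : Fin k => frechetDist (τ i) (C j))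
    exact ⟨j, j.2, hj.trans_le (h ⟨i, hi⟩)⟩
  · intro h i
    obtain ⟨j, hj, hd⟩ := h i i.2
    exact (ciInf_le (Set.finite_range _).bddBelow (⟨j, hj⟩ : Fin k)).trans hd

/-- Lemma 4.1: suppose some set `Cst` of `k` centers in `Δ_ℓ`
has `(k,ℓ)`-center cost at most `α` on `P`. Let `sg i` be an `α`-signature of
`τ i`, and `U` the union over all signature vertices `v` of the intervals
`[v - 4α, v + 4α]`. Then (a) the Lebesgue measure of `U` is at most `24·α·k·ℓ`,
and (b) there are `k` curves, each with at most `ℓ` vertices all lying in `U`,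
whose `(k,ℓ)`-center cost on `P` is at most `α`. -/
theorem candidate_region_center (n : ℕ) (hn : 0 < n)
    (τ : ℕ → ℝ → ℝ) (m : ℕ → ℕ) (t w : ℕ → ℕ → ℝ)
    (hP : ∀ i, i < n → IsPolyOn (τ i) (m i) (t i) (w i) ∧ GenPos (m i) (w i))
    (k ℓ : ℕ) (hk : 0 < k) (α : ℝ) (hα : 0 < α)
    (Cst : ℕ → ℝ → ℝ) (hCst : ∀ j, j < k → InDeltaL ℓ (Cst j))
    (hcost : costC n k τ Cst ≤ α)
    (L : ℕ → ℕ) (sg : ℕ → ℕ → ℝ)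
    (hsig : ∀ i, i < n → IsSignature α (τ i) (L i) (sg i) ∧
        ∀ j, j < L i → ∃ j', j' < m i ∧ sg i j = t i j')
    (U : Set ℝ)
    (hU : U = {y : ℝ | ∃ i, i < n ∧ ∃ j, j < L i ∧ |y - τ i (sg i j)| ≤ 4 * α}) :
    MeasureTheory.volume U ≤ ENNReal.ofReal (24 * α * (k : ℝ) * (ℓ : ℝ)) ∧
    ∃ Ch : ℕ → ℝ → ℝ,
      (∀ j, j < k → ∃ (m' : ℕ) (t' w' : ℕ → ℝ), m' ≤ ℓ ∧
          IsPolyOn (Ch j) m' t' w' ∧ ∀ v, v < m' → w' v ∈ U) ∧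
      costC n k τ Ch ≤ α := by
  rw [costC_le_iff hn hk] at hcost
  choose! M T W hM hpoly using hCst
  have hτ : ∀ i, i < n → ContinuousOn (τ i) (Icc 0 1) := fun i hi => (hP i hi).1.continuousOn
  constructor
  · have hsub : U ⊆ ⋃ p ∈ Finset.range k ×ˢ Finset.range ℓ,
        Metric.closedBall (W p.1 p.2) (12 * α) := by
      rw [hU]
      rintro y ⟨i, hi, j, hj, hy⟩
      obtain ⟨r, hr, hd⟩ := hcost i hi
      obtain ⟨q, hq, hqd⟩ :=
        exists_vertex_near_signature hα (hτ i hi) (hsig i hi).1 (hpoly r hr) hd hj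
      have hqℓ := hq.trans_le (hM r hr)
      refine mem_biUnion (x := (r, q)) (by simp [hr, hqℓ]) ?_
      rw [Metric.mem_closedBall, Real.dist_eq]
      linarith [abs_sub_le y (τ i (sg i j)) (W r q)]
    refine (MeasureTheory.measure_mono hsub).trans
      ((MeasureTheory.measure_biUnion_finset_le _ _).trans_eq ?_)
    simp only [Real.volume_closedBall, Finset.sum_const, Finset.card_product, Finset.card_range,
      nsmul_eq_mul]
    rw [← ENNReal.ofReal_natCast, ← ENNReal.ofReal_mul (by positivity)]
    congr 1
    push_cast
    ring
  · have hfar : ∀ y, y ∉ U → ∀ i, i < n → ∀ j, j < L i → 4 * α < |y - τ i (sg i j)| := by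
      intro y hy i hi j hj
      by_contra! h
      exact hy (hU ▸ ⟨i, hi, j, hj, h⟩)
    have hcenter : ∀ j, j < k → ∃ (c : ℝ → ℝ) (m' : ℕ) (t' w' : ℕ → ℝ), m' ≤ ℓ ∧
        IsPolyOn c m' t' w' ∧ (∀ v, v < m' → w' v ∈ U) ∧
        ∀ i, i < n → frechetDist (τ i) (Cst j) ≤ α → frechetDist (τ i) c ≤ α := by
      intro j hj
      by_cases hS : {i | i < n ∧ frechetDist (τ i) (Cst j) ≤ α}.Nonempty
      · obtain ⟨c, m', t', w', hm', hc, hd, hw⟩ := exists_center_near_signatures hα hS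
          (fun i hi => hτ i hi.1) (fun i hi => (hsig i hi.1).1)
          (fun y hy i hi => hfar y hy i hi.1) (hpoly j hj) (fun i hi => hi.2)
        exact ⟨c, m', t', w', hm'.trans (hM j hj), hc, hw, fun i hi h => hd i ⟨hi, h⟩⟩
      · refine ⟨fun _ => τ 0 (sg 0 0), 2, fun i => i, fun _ => τ 0 (sg 0 0),
          (hpoly j hj).1.trans (hM j hj), ⟨le_rfl, by simp, by simp, fun i _ => by simp,
            fun i _ u _ => by simp⟩, fun v _ => ?_, fun i hi h => absurd ⟨i, hi, h⟩ hS⟩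
        rw [hU]
        refine ⟨0, hn, 0, by have := (hsig 0 hn).1.1; omega, ?_⟩
        rw [sub_self, abs_zero]
        positivity
    choose! Ch m' t' w' hm' hCh hw' hd' using hcenter
    refine ⟨Ch, fun j hj => ⟨m' j, t' j, w' j, hm' j hj, hCh j hj, hw' j hj⟩, ?_⟩
    rw [costC_le_iff hn hk]
    intro i hi
    obtain ⟨j, hj, hd⟩ := hcost i hi
    exact ⟨j, hj, hd' j hj i hi hd⟩
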